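/- arXiv:1906.07543 — 3 statements merged into one kernel-verified Lean document; each statement's English description precedes it below -/
import Mathlib

section
/- Let (E,ρ) be a Polish metric space, T>0, and let x↦P^x be a measurable family of probability measures on the free path space E_T = C([0,T];E) such that the pushforward of P^x under the evaluation map u₀(ξ)=ξ₀ equals δ_x for every x∈E; for μ∈P(E) set P^μ = ∫_E P^x μ(dx). Assume there are constants c₁,c₂∈(0,∞) such that (i) W_{2,T}(Q,P^x)² ≤ c₁ H(Q|P^x) for every x∈E and every probability measure Q on E_T, and (ii) W_{2,T}(P^x,P^y)² ≤ c₂ ρ(x,y)² for all x,y∈E. If μ∈P(E) satisfies W₂(ν,μ)² ≤ c₀ H(ν|μ) for all ν∈P(E) and some constant c₀∈(0,∞), then W_{2,T}(Q,P^μ)² ≤ C·H(Q|P^μ) holds for every probability measure Q on E_T, with the constant C = (√c₁ + √(c₀c₂))². -/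
open MeasureTheory ENNReal
open scoped Classical

/-- The squared quadratic Wasserstein distance `W₂(μ,ν)²`:
the infimum over all couplings `π` of `μ` and `ν` of `∫ d(x,y)² dπ`. -/
noncomputable def W2sq {X : Type*} [MeasurableSpace X] [MetricSpace X]
    (μ ν : Measure X) : ℝ≥0∞ :=
  ⨅ (π : Measure (X × X)) (_ : π.map Prod.fst = μ ∧ π.map Prod.snd = ν),
    ∫⁻ p, ENNReal.ofReal (dist p.1 p.2 ^ 2) ∂π

/-- The relative entropy `H(μ|ν) = ∫ log (dμ/dν) dμ` if `μ ≪ ν`, and `∞` otherwise.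
For probability measures it is written, with `f = dμ/dν`, as the (always defined)
integral `∫ (f log f - f + 1) dν` of a nonnegative integrand, which coincides with
`∫ f log f dν = ∫ log (dμ/dν) dμ` since `∫ (1 - f) dν = 0`. -/
noncomputable def relEntropy {X : Type*} [MeasurableSpace X] (μ ν : Measure X) : ℝ≥0∞ :=
  if μ ≪ ν then
    ∫⁻ x, ENNReal.ofReal
      ((μ.rnDeriv ν x).toReal * Real.log ((μ.rnDeriv ν x).toReal)
        - (μ.rnDeriv ν x).toReal + 1) ∂ν
  else ⊤

/-- The free path space `E_T = C([0,T];E)`, equipped with the uniform metric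
`ρ_T(ξ,η) = sup_{t∈[0,T]} ρ(ξ_t,η_t)` (the `MetricSpace` instance on continuous
maps from a compact space) and its Borel σ-algebra. -/
abbrev PathSpace (E : Type*) [MetricSpace E] (T : ℝ) := C(Set.Icc (0:ℝ) T, E)

noncomputable instance pathMS (E : Type*) [MetricSpace E] (T : ℝ) :
    MeasurableSpace (PathSpace E T) := borel _

instance (E : Type*) [MetricSpace E] (T : ℝ) : BorelSpace (PathSpace E T) := ⟨rfl⟩

open ProbabilityTheory InformationTheory Filter Topology

theorem polishSpace_continuousMap {K Y : Type*} [TopologicalSpace K] [CompactSpace K] [T2Space K]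
    [SecondCountableTopology K] [TopologicalSpace Y] [PolishSpace Y] :
    PolishSpace C(K, Y) := by
  let := TopologicalSpace.upgradeIsCompletelyMetrizable Y
  infer_instance

section Entropy

variable {X : Type*} [MeasurableSpace X]

theorem relEntropy_withDensity (p : Measure X) [SigmaFinite p] {D : X → ℝ≥0∞}
    (hD : Measurable D) :
    relEntropy (p.withDensity D) p = ∫⁻ x, ENNReal.ofReal (klFun (D x).toReal) ∂p := by
  rw [relEntropy, if_pos (withDensity_absolutelyContinuous _ _)]
  refine lintegral_congr_ae ?_
  filter_upwards [Measure.rnDeriv_withDensity p hD] with x hx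
  rw [hx, klFun_apply]
  congr 1
  ring

theorem klFun_lintegral_add_le (p : Measure X) [IsProbabilityMeasure p] {F : X → ℝ}
    (hF : Measurable F) (hF0 : ∀ x, 0 ≤ F x) {g : ℝ≥0∞}
    (hg : ∫⁻ x, ENNReal.ofReal (F x) ∂p = g) (hgtop : g ≠ ⊤) :
    ENNReal.ofReal (klFun g.toReal) + g * ∫⁻ x, ENNReal.ofReal (klFun (F x / g.toReal)) ∂p
      ≤ ∫⁻ x, ENNReal.ofReal (klFun (F x)) ∂p := by
  rcases eq_or_ne g 0 with h0 | h0
  · have hF' : ∀ᵐ x ∂p, F x = 0 := by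
      rw [h0, lintegral_eq_zero_iff (by fun_prop)] at hg
      filter_upwards [hg] with x hx
      exact le_antisymm (by simpa using hx) (hF0 x)
    have : ∫⁻ x, ENNReal.ofReal (klFun (F x)) ∂p = ∫⁻ _, 1 ∂p := by
      refine lintegral_congr_ae ?_
      filter_upwards [hF'] with x hx
      simp [hx, klFun_zero]
    simp [this, h0, klFun_zero]
  rcases eq_or_ne (∫⁻ x, ENNReal.ofReal (klFun (F x)) ∂p) ⊤ with ht | ht
  · simp [ht]
  set G := g.toReal with hG
  have hGpos : 0 < G := ENNReal.toReal_pos h0 hgtop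
  have hgG : g = ENNReal.ofReal G := (ENNReal.ofReal_toReal hgtop).symm
  have hFint : Integrable F p :=
    (lintegral_ofReal_ne_top_iff_integrable hF.aestronglyMeasurable
      (ae_of_all _ hF0)).1 (by rwa [hg])
  have hKint : Integrable (fun x => klFun (F x)) p :=
    (lintegral_ofReal_ne_top_iff_integrable (measurable_klFun.comp hF).aestronglyMeasurable
      (ae_of_all _ fun x => klFun_nonneg (hF0 x))).1 ht
  have hFG : ∫ x, F x ∂p = G := by
    rw [integral_eq_lintegral_of_nonneg_ae (ae_of_all _ hF0) hF.aestronglyMeasurable, hg]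
  have hid : ∀ x, G * klFun (F x / G) = klFun (F x) - klFun G - (F x - G) * Real.log G := by
    intro x
    rcases (hF0 x).eq_or_lt with h | h
    · simp [← h, klFun_apply]; ring
    · rw [klFun_apply, klFun_apply, klFun_apply, Real.log_div h.ne' hGpos.ne']
      field_simp
      ring
  have h_int : Integrable (fun x => G * klFun (F x / G)) p := by
    simp_rw [hid]
    exact (hKint.sub (integrable_const _)).sub ((hFint.sub (integrable_const _)).mul_const _)
  have hval : ∫ x, G * klFun (F x / G) ∂p = ∫ x, klFun (F x) ∂p - klFun G := by
    simp_rw [hid]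
    have h1 : Integrable (fun x => klFun (F x) - klFun G) p := hKint.sub (integrable_const _)
    have h2 : Integrable (fun x => (F x - G) * Real.log G) p :=
      (hFint.sub (integrable_const _)).mul_const _
    rw [integral_sub h1 h2, integral_sub hKint (integrable_const _),
      integral_mul_const, integral_sub hFint (integrable_const _), hFG]
    simp
  have hnn : ∀ x, 0 ≤ G * klFun (F x / G) := fun x =>
    mul_nonneg hGpos.le (klFun_nonneg (div_nonneg (hF0 x) hGpos.le))
  rw [← lintegral_const_mul' _ _ hgtop]
  simp_rw [hgG, ← ENNReal.ofReal_mul hGpos.le]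
  rw [← ofReal_integral_eq_lintegral_ofReal h_int (ae_of_all _ hnn),
    ← ofReal_integral_eq_lintegral_ofReal hKint (ae_of_all _ fun x => klFun_nonneg (hF0 x)),
    ← ENNReal.ofReal_add (klFun_nonneg hGpos.le) (integral_nonneg hnn), hval]
  simp

end Entropy

section Wasserstein

variable {X : Type*} [MetricSpace X] [MeasurableSpace X]

theorem W2sq_le_of_coupling {a b : Measure X} (π : Measure (X × X))
    (h1 : π.map Prod.fst = a) (h2 : π.map Prod.snd = b) :
    W2sq a b ≤ ∫⁻ p, ENNReal.ofReal (dist p.1 p.2 ^ 2) ∂π :=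
  iInf₂_le π ⟨h1, h2⟩

theorem exists_coupling_of_W2sq_lt {a b : Measure X} {t : ℝ≥0∞} (h : W2sq a b < t) :
    ∃ π : Measure (X × X), π.map Prod.fst = a ∧ π.map Prod.snd = b ∧
      ∫⁻ p, ENNReal.ofReal (dist p.1 p.2 ^ 2) ∂π < t := by
  obtain ⟨π, hπ⟩ := iInf_lt_iff.1 h
  obtain ⟨h', hπ⟩ := iInf_lt_iff.1 hπ
  exact ⟨π, h'.1, h'.2, hπ⟩

theorem W2sq_rpow (a b : Measure X) :
    W2sq a b ^ (1 / 2 : ℝ) =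
      ⨅ (π : Measure (X × X)) (_ : π.map Prod.fst = a ∧ π.map Prod.snd = b),
        (∫⁻ p, ENNReal.ofReal (dist p.1 p.2 ^ 2) ∂π) ^ (1 / 2 : ℝ) := by
  have := fun (f : ℝ≥0∞) =>
    ENNReal.orderIsoRpow_apply (1 / 2) (by norm_num) f
  simp_rw [← this, W2sq, OrderIso.map_iInf]

theorem exists_gluing {Y : Type*} [MeasurableSpace Y] [StandardBorelSpace Y] [Nonempty Y]
    (π₁ π₂ : Measure (Y × Y)) [IsProbabilityMeasure π₁] [IsProbabilityMeasure π₂]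
    (h : π₁.map Prod.snd = π₂.map Prod.fst) :
    ∃ π : Measure ((Y × Y) × Y), π.map Prod.fst = π₁ ∧
      π.map (fun p => (p.1.2, p.2)) = π₂ := by
  refine ⟨π₁ ⊗ₘ (π₂.condKernel.comap Prod.snd measurable_snd), ?_, ?_⟩
  · exact Measure.fst_compProd _ _
  · conv_rhs => rw [← π₂.disintegrate π₂.condKernel]
    ext s hs
    rw [Measure.map_apply (by fun_prop) hs,
      Measure.compProd_apply ((by fun_prop : Measurable fun p : (Y × Y) × Y => (p.1.2, p.2)) hs),
      Measure.compProd_apply hs, Measure.fst, ← h,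
      lintegral_map (Kernel.measurable_kernel_prodMk_left hs) measurable_snd]
    rfl

theorem W2sq_rpow_triangle [SecondCountableTopology X] [BorelSpace X] [StandardBorelSpace X]
    (a b c : Measure X) [IsProbabilityMeasure a] [IsProbabilityMeasure b] :
    W2sq a c ^ (1 / 2 : ℝ) ≤ W2sq a b ^ (1 / 2 : ℝ) + W2sq b c ^ (1 / 2 : ℝ) := by
  have : Nonempty X := a.nonempty_of_neZero
  rw [W2sq_rpow a b, W2sq_rpow b c]
  simp_rw [ENNReal.iInf_add, ENNReal.add_iInf]
  refine le_iInf₂ fun π₁ h₁ => le_iInf₂ fun π₂ h₂ => ?_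
  have : IsProbabilityMeasure π₁ := by
    have : IsProbabilityMeasure (π₁.map Prod.fst) := by rw [h₁.1]; infer_instance
    exact Measure.isProbabilityMeasure_of_map (μ := π₁) Prod.fst
  have : IsProbabilityMeasure π₂ := by
    have : IsProbabilityMeasure (π₂.map Prod.fst) := by rw [h₂.1]; infer_instance
    exact Measure.isProbabilityMeasure_of_map (μ := π₂) Prod.fst
  obtain ⟨π, hπ₁, hπ₂⟩ := exists_gluing π₁ π₂ (h₁.2.trans h₂.1.symm)
  have hm : Measurable fun p : X × X => ENNReal.ofReal (dist p.1 p.2 ^ 2) := by fun_prop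
  have hm' : Measurable fun p : (X × X) × X => (p.1.2, p.2) := by fun_prop
  have hm'' : Measurable fun p : (X × X) × X => (p.1.1, p.2) := by fun_prop
  have hle := W2sq_le_of_coupling (a := a) (b := c) (π.map fun p => (p.1.1, p.2))
    (by
      rw [Measure.map_map measurable_fst hm'', ← h₁.1, ← hπ₁,
        Measure.map_map measurable_fst measurable_fst]
      rfl)
    (by
      rw [Measure.map_map measurable_snd hm'', ← h₂.2, ← hπ₂, Measure.map_map measurable_snd hm']
      rfl)
  rw [lintegral_map hm hm''] at hle
  rw [← hπ₁, ← hπ₂, lintegral_map hm measurable_fst, lintegral_map hm hm']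
  have key := ENNReal.lintegral_Lp_add_le (μ := π) (p := 2)
    (f := fun p => ENNReal.ofReal (dist p.1.1 p.1.2))
    (g := fun p => ENNReal.ofReal (dist p.1.2 p.2)) (by fun_prop) (by fun_prop) (by norm_num)
  have hpow : ∀ r : ℝ, 0 ≤ r → ENNReal.ofReal r ^ (2 : ℝ) = ENNReal.ofReal (r ^ 2) := by
    intro r hr
    rw [ENNReal.ofReal_rpow_of_nonneg hr (by norm_num)]
    norm_num
  simp_rw [hpow _ dist_nonneg] at key
  refine (ENNReal.rpow_le_rpow (hle.trans (lintegral_mono fun p => ?_)) (by norm_num)).trans key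
  rw [← hpow _ dist_nonneg]
  refine ENNReal.rpow_le_rpow ?_ (by norm_num)
  simp only [Pi.add_apply]
  rw [← ENNReal.ofReal_add dist_nonneg dist_nonneg]
  exact ENNReal.ofReal_le_ofReal (dist_triangle _ _ _)

end Wasserstein

section CellCoupling

/-- `q` has row sums at most `a` and column sums at most `b`. -/
def IsSubcoupling (a b : ℕ → ℝ≥0∞) (q : ℕ → ℕ → ℝ≥0∞) : Prop :=
  (∀ i, ∑' j, q i j ≤ a i) ∧ ∀ j, ∑' i, q i j ≤ b j

/-- The density, relative to the product of two measures with cell masses `a` and `b`, of the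
coupling that gives mass `q i j` to the pair of cells `(i, j)` and distributes the remaining mass
independently. -/
noncomputable def cellDensity (a b : ℕ → ℝ≥0∞) (q : ℕ → ℕ → ℝ≥0∞) (i j : ℕ) : ℝ≥0∞ :=
  q i j / (a i * b j) +
    (a i - ∑' j, q i j) / a i * ((b j - ∑' i, q i j) / b j) / ∑' i, (a i - ∑' j, q i j)

variable {a b : ℕ → ℝ≥0∞} {q : ℕ → ℕ → ℝ≥0∞}

theorem IsSubcoupling.flip (h : IsSubcoupling a b q) : IsSubcoupling b a (flip q) :=
  ⟨h.2, h.1⟩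

theorem IsSubcoupling.tsum_sub_eq (h : IsSubcoupling a b q) (ha : ∑' i, a i = 1)
    (hb : ∑' j, b j = 1) :
    ∑' i, (a i - ∑' j, q i j) = ∑' j, (b j - ∑' i, q i j) := by
  have h1 : ∑' i, ∑' j, q i j ≠ ⊤ :=
    ne_top_of_le_ne_top (by rw [ha]; exact one_ne_top) (ENNReal.tsum_le_tsum h.1)
  have h2 : ∑' j, ∑' i, q i j ≠ ⊤ :=
    ne_top_of_le_ne_top (by rw [hb]; exact one_ne_top) (ENNReal.tsum_le_tsum h.2)
  rw [ENNReal.tsum_sub h1 h.1, ENNReal.tsum_sub h2 h.2, ha, hb, ENNReal.tsum_comm]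

theorem cellDensity_flip (h : IsSubcoupling a b q) (ha : ∑' i, a i = 1)
    (hb : ∑' j, b j = 1) (i j : ℕ) :
    cellDensity b a (flip q) j i = cellDensity a b q i j := by
  simp only [cellDensity, _root_.flip]
  rw [h.tsum_sub_eq ha hb, mul_comm (b j), mul_comm ((b j - _) / _)]

theorem tsum_cellDensity_mul (h : IsSubcoupling a b q) (ha : ∑' i, a i = 1)
    (hb : ∑' j, b j = 1) {i : ℕ} (hi : a i ≠ 0) :
    ∑' j, cellDensity a b q i j * b j = 1 := by
  have hafin : ∀ i, a i ≠ ⊤ := fun i =>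
    ne_top_of_le_ne_top (by rw [ha]; exact one_ne_top) (ENNReal.le_tsum i)
  have hbfin : ∀ i, b i ≠ ⊤ := fun i =>
    ne_top_of_le_ne_top (by rw [hb]; exact one_ne_top) (ENNReal.le_tsum i)
  set m := ∑' i, (a i - ∑' j, q i j) with hm
  have hmb : m = ∑' j, (b j - ∑' i, q i j) := h.tsum_sub_eq ha hb
  have hmfin : m ≠ ⊤ := ne_top_of_le_ne_top (by rw [ha]; exact one_ne_top)
    (ENNReal.tsum_le_tsum fun i => tsub_le_self)
  have hterm : ∀ j, cellDensity a b q i j * b j =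
      (a i)⁻¹ * q i j + (a i - ∑' j, q i j) / a i / m * (b j - ∑' i, q i j) := by
    intro j
    rcases eq_or_ne (b j) 0 with hj | hj
    · have : q i j = 0 := by
        have := (ENNReal.le_tsum (f := fun i => q i j) i).trans (h.2 j)
        rw [hj] at this
        simpa using this
      simp [hj, this]
    · rw [cellDensity, add_mul, ← hm]
      congr 1
      · rw [div_eq_mul_inv, ENNReal.mul_inv (Or.inl hi) (Or.inl (hafin i)), mul_assoc, mul_assoc,
          ENNReal.inv_mul_cancel hj (hbfin j), mul_one, mul_comm]
      · simp only [div_eq_mul_inv]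
        rw [show ∀ x y z w v t : ℝ≥0∞, x * y * (z * w) * v * t = x * y * v * z * (w * t) by
          intros; ring, ENNReal.inv_mul_cancel hj (hbfin j), mul_one]
  simp_rw [hterm]
  rw [ENNReal.tsum_add, ENNReal.tsum_mul_left, ENNReal.tsum_mul_left, ← hmb]
  have hrest : (a i - ∑' j, q i j) / a i / m * m = (a i - ∑' j, q i j) / a i := by
    rcases eq_or_ne m 0 with h0 | h0
    · have : a i - ∑' j, q i j = 0 := by
        have := ENNReal.le_tsum (f := fun i => a i - ∑' j, q i j) i
        rw [← hm, h0] at this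
        simpa using this
      simp [this]
    · exact ENNReal.div_mul_cancel h0 hmfin
  rw [hrest, mul_comm, ← div_eq_mul_inv, ← ENNReal.add_div, add_tsub_cancel_of_le (h.1 i),
    ENNReal.div_self hi (hafin i)]

variable {X : Type*} [MeasurableSpace X] {φ : X → ℕ}

theorem ae_measure_fiber_ne_zero (α : Measure X) (φ : X → ℕ) :
    ∀ᵐ x ∂α, α (φ ⁻¹' {φ x}) ≠ 0 := by
  have : ∀ᵐ x ∂α, ∀ i, α (φ ⁻¹' {i}) = 0 → φ x ≠ i := by
    rw [ae_all_iff]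
    intro i
    by_cases h : α (φ ⁻¹' {i}) = 0
    · filter_upwards [measure_eq_zero_iff_ae_notMem.1 h] with x hx _
      simpa using hx
    · exact ae_of_all _ fun x h' => absurd h' h
  filter_upwards [this] with x hx h
  exact hx _ h rfl

theorem tsum_measure_fiber (α : Measure X) [IsProbabilityMeasure α] (hφ : Measurable φ) :
    ∑' i, α (φ ⁻¹' {i}) = 1 := by
  have := lintegral_countable' (μ := α.map φ) (fun _ => 1)
  simp_rw [Measure.map_apply hφ (measurableSet_singleton _), one_mul] at this
  rw [← this, lintegral_const, Measure.map_apply hφ .univ]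
  simp

theorem map_fst_withDensity_fiber (α β : Measure X) [IsProbabilityMeasure α]
    [IsProbabilityMeasure β] (hφ : Measurable φ) {h : ℕ → ℕ → ℝ≥0∞}
    (hh : ∀ i, α (φ ⁻¹' {i}) ≠ 0 → ∑' j, h i j * β (φ ⁻¹' {j}) = 1) :
    ((α.prod β).withDensity fun p => h (φ p.1) (φ p.2)).map Prod.fst = α := by
  have hm : Measurable fun z : ℕ × ℕ => h z.1 z.2 := measurable_of_countable _
  have hm' : Measurable fun p : X × X => h (φ p.1) (φ p.2) :=
    hm.comp (by fun_prop : Measurable fun p : X × X => (φ p.1, φ p.2))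
  ext s hs
  rw [Measure.map_apply measurable_fst hs, withDensity_apply _ (measurable_fst hs),
    ← lintegral_indicator (measurable_fst hs),
    lintegral_prod _ (hm'.indicator (measurable_fst hs)).aemeasurable]
  have : ∀ᵐ x ∂α, ∫⁻ y, (Prod.fst ⁻¹' s).indicator (fun p : X × X => h (φ p.1) (φ p.2)) (x, y) ∂β
      = s.indicator 1 x := by
    filter_upwards [ae_measure_fiber_ne_zero α φ] with x hx
    by_cases hxs : x ∈ s
    · have : ∀ y, (Prod.fst ⁻¹' s).indicator (fun p : X × X => h (φ p.1) (φ p.2)) (x, y)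
          = h (φ x) (φ y) := fun y => Set.indicator_of_mem (by simpa using hxs) _
      simp_rw [this]
      rw [← lintegral_map (f := fun j => h (φ x) j) (measurable_of_countable _) hφ,
        lintegral_countable']
      simp_rw [Measure.map_apply hφ (measurableSet_singleton _)]
      simp [hh _ hx, hxs]
    · have : ∀ y, (Prod.fst ⁻¹' s).indicator (fun p : X × X => h (φ p.1) (φ p.2)) (x, y)
          = 0 := fun y => Set.indicator_of_notMem (by simpa using hxs) _
      simp [hxs]
  rw [lintegral_congr_ae this, lintegral_indicator_one hs]

theorem map_snd_withDensity_fiber (α β : Measure X) [IsProbabilityMeasure α]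
    [IsProbabilityMeasure β] (hφ : Measurable φ) {h : ℕ → ℕ → ℝ≥0∞}
    (hh : ∀ j, β (φ ⁻¹' {j}) ≠ 0 → ∑' i, h i j * α (φ ⁻¹' {i}) = 1) :
    ((α.prod β).withDensity fun p => h (φ p.1) (φ p.2)).map Prod.snd = β := by
  have hm : Measurable fun z : ℕ × ℕ => h z.1 z.2 := measurable_of_countable _
  have hm' : Measurable fun p : X × X => h (φ p.1) (φ p.2) :=
    hm.comp (by fun_prop : Measurable fun p : X × X => (φ p.1, φ p.2))
  conv_rhs => rw [← map_fst_withDensity_fiber β α hφ (h := flip h) hh]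
  ext s hs
  rw [Measure.map_apply measurable_snd hs, Measure.map_apply measurable_fst hs,
    withDensity_apply _ (measurable_snd hs), withDensity_apply _ (measurable_fst hs),
    ← Measure.prod_swap, Measure.restrict_map measurable_swap (measurable_snd hs),
    lintegral_map hm' measurable_swap]
  rfl

theorem lintegral_fiber (M : Measure (X × X)) (hφ : Measurable φ) (H : ℕ → ℕ → ℝ≥0∞) :
    ∫⁻ p, H (φ p.1) (φ p.2) ∂M =
      ∑' z : ℕ × ℕ, H z.1 z.2 * M ((φ ⁻¹' {z.1}) ×ˢ (φ ⁻¹' {z.2})) := by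
  have hm : Measurable fun p : X × X => (φ p.1, φ p.2) := by fun_prop
  rw [← lintegral_map (f := fun z : ℕ × ℕ => H z.1 z.2) (measurable_of_countable _) hm,
    lintegral_countable']
  refine tsum_congr fun z => ?_
  rw [Measure.map_apply hm (measurableSet_singleton _)]
  congr 2
  ext p
  simp [Prod.ext_iff]

/-- The coupling of `α` and `β` with density `cellDensity` relative to `α.prod β`. -/
noncomputable def cellCoupling (φ : X → ℕ) (q : ℕ → ℕ → ℝ≥0∞) (α β : Measure X) :
    Measure (X × X) :=
  (α.prod β).withDensity fun p =>
    cellDensity (fun i => α (φ ⁻¹' {i})) (fun j => β (φ ⁻¹' {j})) q (φ p.1) (φ p.2)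

theorem map_fst_cellCoupling (α β : Measure X) [IsProbabilityMeasure α]
    [IsProbabilityMeasure β] (hφ : Measurable φ)
    (h : IsSubcoupling (fun i => α (φ ⁻¹' {i})) (fun j => β (φ ⁻¹' {j})) q) :
    (cellCoupling φ q α β).map Prod.fst = α :=
  map_fst_withDensity_fiber α β hφ fun _ hi =>
    tsum_cellDensity_mul h (tsum_measure_fiber α hφ) (tsum_measure_fiber β hφ) hi

theorem map_snd_cellCoupling (α β : Measure X) [IsProbabilityMeasure α]
    [IsProbabilityMeasure β] (hφ : Measurable φ)
    (h : IsSubcoupling (fun i => α (φ ⁻¹' {i})) (fun j => β (φ ⁻¹' {j})) q) :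
    (cellCoupling φ q α β).map Prod.snd = β := by
  refine map_snd_withDensity_fiber α β hφ fun j hj => ?_
  simp_rw [← cellDensity_flip h (tsum_measure_fiber α hφ) (tsum_measure_fiber β hφ)]
  exact tsum_cellDensity_mul h.flip (tsum_measure_fiber β hφ) (tsum_measure_fiber α hφ) hj

theorem lintegral_cellCoupling_le (α β : Measure X) [IsProbabilityMeasure α]
    [IsProbabilityMeasure β] (hφ : Measurable φ)
    (h : IsSubcoupling (fun i => α (φ ⁻¹' {i})) (fun j => β (φ ⁻¹' {j})) q)
    {c : X × X → ℝ≥0∞} (hc : Measurable c) {s : ℕ → ℕ → ℝ≥0∞} {e : X → ℝ≥0∞}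
    (he : Measurable e) (hcs : ∀ p, c p ≤ s (φ p.1) (φ p.2))
    (hce : ∀ p, c p ≤ 2 * (e p.1 + e p.2)) :
    ∫⁻ p, c p ∂(cellCoupling φ q α β) ≤ ∑' z : ℕ × ℕ, s z.1 z.2 * q z.1 z.2 +
      2 * ∫⁻ x, e x * ((α (φ ⁻¹' {φ x}) - ∑' j, q (φ x) j) / α (φ ⁻¹' {φ x})) ∂α +
      2 * ∫⁻ y, e y * ((β (φ ⁻¹' {φ y}) - ∑' i, q i (φ y)) / β (φ ⁻¹' {φ y})) ∂β := by
  set a : ℕ → ℝ≥0∞ := fun i => α (φ ⁻¹' {i}) with ha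
  set b : ℕ → ℝ≥0∞ := fun i => β (φ ⁻¹' {i}) with hb
  set u : ℕ → ℝ≥0∞ := fun i => (a i - ∑' j, q i j) / a i with hu
  set v : ℕ → ℝ≥0∞ := fun j => (b j - ∑' i, q i j) / b j with hv
  set m := ∑' i, (a i - ∑' j, q i j) with hm
  have hmb : m = ∑' j, (b j - ∑' i, q i j) :=
    h.tsum_sub_eq (tsum_measure_fiber α hφ) (tsum_measure_fiber β hφ)
  have hfib : ∀ (ρ : Measure X) (w : ℕ → ℝ≥0∞), ∫⁻ x, w (φ x) ∂ρ = ∑' i, w i * ρ (φ ⁻¹' {i}) := by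
    intro ρ w
    rw [← lintegral_map (f := w) (measurable_of_countable _) hφ, lintegral_countable']
    simp_rw [Measure.map_apply hφ (measurableSet_singleton _)]
  have hdiv : ∀ x y : ℝ≥0∞, x / y * y ≤ x := fun x y => by
    rw [mul_comm]; exact ENNReal.mul_div_le
  have hum : ∫⁻ x, u (φ x) ∂α ≤ m := by
    rw [hfib]; exact ENNReal.tsum_le_tsum fun i => hdiv _ _
  have hvm : ∫⁻ y, v (φ y) ∂β ≤ m := by
    rw [hfib, hmb]; exact ENNReal.tsum_le_tsum fun i => hdiv _ _
  have hmeas : ∀ H : ℕ → ℕ → ℝ≥0∞, Measurable fun p : X × X => H (φ p.1) (φ p.2) := fun H =>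
    (measurable_of_countable fun z : ℕ × ℕ => H z.1 z.2).comp
      (by fun_prop : Measurable fun p : X × X => (φ p.1, φ p.2))
  have hmu : Measurable fun x => u (φ x) := (measurable_of_countable u).comp hφ
  have hmv : Measurable fun x => v (φ x) := (measurable_of_countable v).comp hφ
  rw [cellCoupling, lintegral_withDensity_eq_lintegral_mul _ (hmeas _) hc]
  have hbound : ∀ p : X × X, cellDensity a b q (φ p.1) (φ p.2) * c p ≤
      s (φ p.1) (φ p.2) * (q (φ p.1) (φ p.2) / (a (φ p.1) * b (φ p.2))) +
      (2 * m⁻¹ * ((e p.1 * u (φ p.1)) * v (φ p.2)) +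
        2 * m⁻¹ * (u (φ p.1) * (e p.2 * v (φ p.2)))) := by
    intro p
    rw [cellDensity, add_mul]
    gcongr ?_ + ?_
    · rw [mul_comm]
      exact mul_le_mul_left (hcs p) _
    · refine (mul_le_mul_right (hce p) _).trans_eq ?_
      change u (φ p.1) * v (φ p.2) / m * _ = _
      rw [div_eq_mul_inv]
      ring
  refine (lintegral_mono hbound).trans ?_
  rw [lintegral_add_left (hmeas fun i j => s i j * (q i j / (a i * b j))),
    lintegral_add_left (by fun_prop), add_assoc]
  gcongr ?_ + (?_ + ?_)
  · rw [lintegral_fiber _ hφ (fun i j => s i j * (q i j / (a i * b j)))]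
    refine ENNReal.tsum_le_tsum fun z => ?_
    rw [Measure.prod_prod, mul_assoc]
    exact mul_le_mul_right (hdiv _ _) _
  · rw [lintegral_const_mul _ (by fun_prop), lintegral_prod_mul (f := fun x => e x * u (φ x))
      (g := fun y => v (φ y)) (by fun_prop) (by fun_prop)]
    calc _ ≤ 2 * m⁻¹ * ((∫⁻ x, e x * u (φ x) ∂α) * m) := by gcongr
      _ = 2 * (∫⁻ x, e x * u (φ x) ∂α) * (m⁻¹ * m) := by ring
      _ ≤ 2 * (∫⁻ x, e x * u (φ x) ∂α) * 1 := by gcongr; exact ENNReal.inv_mul_le_one _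
      _ = _ := mul_one _
  · rw [lintegral_const_mul _ (by fun_prop), lintegral_prod_mul (f := fun x => u (φ x))
      (g := fun y => e y * v (φ y)) (by fun_prop) (by fun_prop)]
    calc _ ≤ 2 * m⁻¹ * (m * (∫⁻ x, e x * v (φ x) ∂β)) := by gcongr
      _ = 2 * (∫⁻ x, e x * v (φ x) ∂β) * (m⁻¹ * m) := by ring
      _ ≤ 2 * (∫⁻ x, e x * v (φ x) ∂β) * 1 := by gcongr; exact ENNReal.inv_mul_le_one _
      _ = _ := mul_one _

theorem measurable_cellCoupling {Ω : Type*} [MeasurableSpace Ω] (hφ : Measurable φ)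
    (q : ℕ → ℕ → ℝ≥0∞) (α β : Kernel Ω X) [IsMarkovKernel α] [IsMarkovKernel β] :
    Measurable fun ω => cellCoupling φ q (α ω) (β ω) := by
  let D : Ω → X × X → ℝ≥0∞ := fun ω p =>
    cellDensity (fun i => α ω (φ ⁻¹' {i})) (fun j => β ω (φ ⁻¹' {j})) q (φ p.1) (φ p.2)
  have hD : Measurable (Function.uncurry D) := by
    have h1 : Measurable fun z : Ω × (ℕ × ℕ) =>
        cellDensity (fun i => α z.1 (φ ⁻¹' {i})) (fun j => β z.1 (φ ⁻¹' {j})) q z.2.1 z.2.2 := by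
      refine measurable_from_prod_countable_left fun z => ?_
      have ha : ∀ i, Measurable fun ω => α ω (φ ⁻¹' {i}) := fun i =>
        α.measurable_coe (hφ (measurableSet_singleton i))
      have hb : ∀ i, Measurable fun ω => β ω (φ ⁻¹' {i}) := fun i =>
        β.measurable_coe (hφ (measurableSet_singleton i))
      unfold cellDensity
      have hS : Measurable fun ω => ∑' i, (α ω (φ ⁻¹' {i}) - ∑' j, q i j) :=
        Measurable.tsum fun i => (ha i).sub_const _
      have hA := ha z.1
      have hB := hb z.2
      simp only
      fun_prop
    exact h1.comp (by fun_prop : Measurable fun z : Ω × (X × X) => (z.1, (φ z.2.1, φ z.2.2)))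
  have : (fun ω => cellCoupling φ q (α ω) (β ω)) = (α ×ₖ β).withDensity D := by
    funext ω
    rw [Kernel.withDensity_apply _ hD, Kernel.prod_apply]
    rfl
  rw [this]
  exact Kernel.measurable _

end CellCoupling

section Selection

theorem exists_measurable_partition (X : Type*) [MetricSpace X] [SecondCountableTopology X]
    [MeasurableSpace X] [BorelSpace X] [Nonempty X] {ε : ℝ} (hε : 0 < ε) :
    ∃ φ : X → ℕ, Measurable φ ∧ ∀ x y, φ x = φ y → dist x y ≤ ε := by
  have hex : ∀ x : X, ∃ n, dist x (TopologicalSpace.denseSeq X n) < ε / 2 := fun x => by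
    obtain ⟨_, hn, n, rfl⟩ :=
      Metric.dense_iff.1 (TopologicalSpace.denseRange_denseSeq X) x (ε / 2) (by positivity)
    exact ⟨n, by rwa [Metric.mem_ball, dist_comm] at hn⟩
  refine ⟨fun x => Nat.find (hex x), measurable_find hex fun k => ?_, fun x y hxy => ?_⟩
  · exact measurableSet_lt (by fun_prop) measurable_const
  · have hx := Nat.find_spec (hex x)
    have hy := Nat.find_spec (hex y)
    simp only at hxy
    rw [← hxy] at hy
    have := dist_triangle_right x y (TopologicalSpace.denseSeq X (Nat.find (hex x)))
    linarith

/-- The finitely supported matrix with entries `n (i, j) / N`. -/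
noncomputable def gridWeight (N : ℕ) (n : (ℕ × ℕ) →₀ ℕ) (i j : ℕ) : ℝ≥0∞ := n (i, j) / N

theorem exists_gridWeight_tendsto (γ : ℕ → ℕ → ℝ≥0∞) (hγ : ∀ i j, γ i j ≠ ⊤) :
    ∃ n : ℕ → (ℕ × ℕ) →₀ ℕ, (∀ N i j, gridWeight N (n N) i j ≤ γ i j) ∧
      ∀ i j, Tendsto (fun N => gridWeight N (n N) i j) atTop (𝓝 (γ i j)) := by
  let n : ℕ → (ℕ × ℕ) →₀ ℕ := fun N =>
    Finsupp.onFinset (Finset.range N ×ˢ Finset.range N)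
      (fun z => if z ∈ Finset.range N ×ˢ Finset.range N then ⌊(γ z.1 z.2).toReal * N⌋₊ else 0)
      (fun z hz => by by_contra h; simp [h] at hz)
  have hfloor : ∀ (N : ℕ) i j, 0 < N → ((⌊(γ i j).toReal * N⌋₊ : ℕ) : ℝ≥0∞) / N =
      ENNReal.ofReal ((⌊(γ i j).toReal * N⌋₊ : ℝ) / N) := fun N i j hN => by
    rw [ENNReal.ofReal_div_of_pos (by exact_mod_cast hN)]
    simp
  refine ⟨n, fun N i j => ?_, fun i j => ?_⟩
  · rcases Nat.eq_zero_or_pos N with rfl | hN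
    · simp [gridWeight, n]
    · by_cases hz : (i, j) ∈ Finset.range N ×ˢ Finset.range N
      · simp only [gridWeight, n, Finsupp.onFinset_apply, if_pos hz]
        rw [hfloor N i j hN]
        refine ENNReal.ofReal_le_of_le_toReal ?_
        rw [div_le_iff₀ (by exact_mod_cast hN)]
        exact Nat.floor_le (by positivity)
      · simp only [gridWeight, n, Finsupp.onFinset_apply, if_neg hz]
        simp
  · have h1 : Tendsto (fun N : ℕ => ENNReal.ofReal ((⌊(γ i j).toReal * N⌋₊ : ℝ) / N)) atTop
        (𝓝 (γ i j)) := by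
      have := ENNReal.tendsto_ofReal ((tendsto_nat_floor_mul_div_atTop
        (ENNReal.toReal_nonneg (a := γ i j))).comp tendsto_natCast_atTop_atTop)
      rw [ENNReal.ofReal_toReal (hγ i j)] at this
      exact this
    refine h1.congr' ?_
    filter_upwards [eventually_gt_atTop i, eventually_gt_atTop j] with N hi hj
    have hz : (i, j) ∈ Finset.range N ×ˢ Finset.range N := by simp [hi, hj]
    rw [← hfloor N i j (by omega)]
    simp only [gridWeight, n, Finsupp.onFinset_apply, if_pos hz]

theorem tendsto_tsum_of_le {f : ℕ → ℕ → ℝ≥0∞} {F : ℕ → ℝ≥0∞} (hle : ∀ N j, f N j ≤ F j)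
    (hF : ∑' j, F j ≠ ⊤) (hf : ∀ j, Tendsto (fun N => f N j) atTop (𝓝 (F j))) :
    Tendsto (fun N => ∑' j, f N j) atTop (𝓝 (∑' j, F j)) := by
  simp_rw [← lintegral_count] at hF ⊢
  exact tendsto_lintegral_of_dominated_convergence F (fun _ => measurable_of_countable _)
    (fun N => ae_of_all _ (hle N)) hF (ae_of_all _ hf)

theorem tendsto_lintegral_cell_defect {X : Type*} [MeasurableSpace X] (α : Measure X)
    [IsProbabilityMeasure α] {φ : X → ℕ} (hφ : Measurable φ) {e : X → ℝ≥0∞} (he : Measurable e)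
    (hefin : ∫⁻ x, e x ∂α ≠ ⊤) {r : ℕ → ℕ → ℝ≥0∞}
    (hr : ∀ i, Tendsto (fun N => r N i) atTop (𝓝 (α (φ ⁻¹' {i})))) :
    Tendsto (fun N => ∫⁻ x, e x * ((α (φ ⁻¹' {φ x}) - r N (φ x)) / α (φ ⁻¹' {φ x})) ∂α) atTop
      (𝓝 0) := by
  rw [← lintegral_zero (μ := α)]
  refine tendsto_lintegral_of_dominated_convergence e (fun N => ?_) (fun N => ae_of_all _ ?_)
    hefin ?_
  · exact he.mul ((measurable_of_countable
      fun i => (α (φ ⁻¹' {i}) - r N i) / α (φ ⁻¹' {i})).comp hφ)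
  · intro x
    refine mul_le_of_le_one_right' ?_
    exact (ENNReal.div_le_div_right tsub_le_self _).trans ENNReal.div_self_le_one
  · filter_upwards [ae_measure_fiber_ne_zero α φ, ae_lt_top he hefin] with x hx hex
    have h1 := ENNReal.Tendsto.sub (tendsto_const_nhds (x := α (φ ⁻¹' {φ x}))) (hr (φ x))
      (Or.inl (measure_ne_top _ _))
    have h2 := ENNReal.Tendsto.const_mul
      (ENNReal.Tendsto.div_const h1 (Or.inr hx)) (Or.inr hex.ne)
    simpa using h2

theorem ofReal_dist_sq_le {X : Type*} [MetricSpace X] (x y o : X) :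
    ENNReal.ofReal (dist x y ^ 2) ≤
      2 * (ENNReal.ofReal (dist x o ^ 2) + ENNReal.ofReal (dist y o ^ 2)) := by
  rw [← ENNReal.ofReal_add (by positivity) (by positivity), ← ENNReal.ofReal_ofNat 2,
    ← ENNReal.ofReal_mul (by norm_num)]
  refine ENNReal.ofReal_le_ofReal ?_
  have h := dist_triangle_right x y o
  have h0 := dist_nonneg (x := x) (y := y)
  nlinarith [sq_nonneg (dist x o - dist y o)]

variable {X : Type*} [MetricSpace X] [SecondCountableTopology X] [MeasurableSpace X]
  [BorelSpace X]

theorem lintegral_dist_sq_ne_top_of_W2sq {α β : Measure X} (h : W2sq α β < ⊤) (o : X)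
    (hβ : ∫⁻ y, ENNReal.ofReal (dist y o ^ 2) ∂β ≠ ⊤) :
    ∫⁻ x, ENNReal.ofReal (dist x o ^ 2) ∂α ≠ ⊤ := by
  obtain ⟨π, h1, h2, hπ⟩ := exists_coupling_of_W2sq_lt h
  rw [← h1, lintegral_map (by fun_prop) measurable_fst]
  rw [← h2, lintegral_map (by fun_prop) measurable_snd] at hβ
  refine ne_top_of_le_ne_top ?_ (lintegral_mono fun p : X × X =>
    (ofReal_dist_sq_le p.1 o p.2).trans_eq (by rw [dist_comm o p.2]))
  rw [lintegral_const_mul _ (by fun_prop), lintegral_add_left (by fun_prop)]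
  exact ENNReal.mul_ne_top (by norm_num) (ENNReal.add_ne_top.2 ⟨hπ.ne, hβ⟩)

theorem exists_cellCoupling_lt [Nonempty X] {α β : Measure X} [IsProbabilityMeasure α]
    [IsProbabilityMeasure β] {φ : ℕ → X → ℕ} (hφ : ∀ k, Measurable (φ k))
    (hφd : ∀ k x y, φ k x = φ k y → dist x y ≤ 1 / ((k : ℝ) + 1)) (o : X)
    (hβo : ∫⁻ y, ENNReal.ofReal (dist y o ^ 2) ∂β ≠ ⊤) {t : ℝ≥0∞} (ht : W2sq α β < t) :
    ∃ (k N : ℕ) (n : (ℕ × ℕ) →₀ ℕ),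
      IsSubcoupling (fun i => α (φ k ⁻¹' {i})) (fun j => β (φ k ⁻¹' {j})) (gridWeight N n) ∧
      ∫⁻ p, ENNReal.ofReal (dist p.1 p.2 ^ 2) ∂(cellCoupling (φ k) (gridWeight N n) α β) < t := by
  have hαo := lintegral_dist_sq_ne_top_of_W2sq (ht.trans_le le_top) o hβo
  obtain ⟨π, h1, h2, hπ⟩ := exists_coupling_of_W2sq_lt ht
  have hprob : IsProbabilityMeasure π := by
    have : IsProbabilityMeasure (π.map Prod.fst) := by rw [h1]; infer_instance
    exact Measure.isProbabilityMeasure_of_map (μ := π) Prod.fst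
  set c := ∫⁻ p, ENNReal.ofReal (dist p.1 p.2 ^ 2) ∂π with hc
  have hcfin : c ≠ ⊤ := (hπ.trans_le le_top).ne
  let δ : ℕ → ℝ := fun k => 1 / ((k : ℝ) + 1)
  have hδ : Tendsto δ atTop (𝓝 0) := tendsto_one_div_add_atTop_nhds_zero_nat
  have hδ0 : ∀ k, 0 ≤ δ k := fun k => by positivity
  obtain ⟨k, hk⟩ : ∃ k, ENNReal.ofReal (1 + 4 * δ k) * c +
      ENNReal.ofReal (4 * δ k + 4 * δ k ^ 2) < t := by
    have hlim : Tendsto (fun k => ENNReal.ofReal (1 + 4 * δ k) * c +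
        ENNReal.ofReal (4 * δ k + 4 * δ k ^ 2)) atTop (𝓝 c) := by
      have l1 : Tendsto (fun k => 1 + 4 * δ k) atTop (𝓝 1) := by
        simpa using (hδ.const_mul 4).const_add 1
      have l2 : Tendsto (fun k => 4 * δ k + 4 * δ k ^ 2) atTop (𝓝 0) := by
        simpa using (hδ.const_mul 4).add ((hδ.pow 2).const_mul 4)
      simpa using (ENNReal.Tendsto.mul_const (ENNReal.tendsto_ofReal l1) (Or.inr hcfin)).add
        (ENNReal.tendsto_ofReal l2)
    exact (hlim.eventually_lt_const hπ).exists
  let s : ℕ → ℕ → ℝ≥0∞ := fun i j =>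
    ⨆ p : {p : X × X // φ k p.1 = i ∧ φ k p.2 = j}, ENNReal.ofReal (dist p.1.1 p.1.2 ^ 2)
  have hs : ∀ p : X × X, ENNReal.ofReal (dist p.1 p.2 ^ 2) ≤ s (φ k p.1) (φ k p.2) := fun p =>
    le_iSup (fun p : {p' : X × X // φ k p'.1 = φ k p.1 ∧ φ k p'.2 = φ k p.2} =>
      ENNReal.ofReal (dist p.1.1 p.1.2 ^ 2)) ⟨p, rfl, rfl⟩
  have hs' : ∀ p : X × X, s (φ k p.1) (φ k p.2) ≤ ENNReal.ofReal (1 + 4 * δ k) *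
      ENNReal.ofReal (dist p.1 p.2 ^ 2) + ENNReal.ofReal (4 * δ k + 4 * δ k ^ 2) := by
    intro p
    refine iSup_le fun p' => ?_
    have hδk := hδ0 k
    rw [← ENNReal.ofReal_mul (by positivity), ← ENNReal.ofReal_add (by positivity) (by positivity)]
    refine ENNReal.ofReal_le_ofReal ?_
    have d1 : dist p'.1.1 p.1 ≤ δ k := hφd k _ _ p'.2.1
    have d2 : dist p.2 p'.1.2 ≤ δ k := hφd k _ _ p'.2.2.symm
    have d3 := dist_triangle4 p'.1.1 p.1 p.2 p'.1.2
    have d4 : dist p'.1.1 p'.1.2 ≤ dist p.1 p.2 + 2 * δ k := by linarith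
    have d5 : dist p'.1.1 p'.1.2 ^ 2 ≤ (dist p.1 p.2 + 2 * δ k) ^ 2 := by gcongr
    nlinarith [mul_nonneg hδk (sq_nonneg (dist p.1 p.2 - 1)), mul_nonneg hδk (dist_nonneg (x := p.1) (y := p.2)),
      mul_nonneg hδk (sq_nonneg (dist p.1 p.2))]
  let γ : ℕ → ℕ → ℝ≥0∞ := fun i j => π ((φ k ⁻¹' {i}) ×ˢ (φ k ⁻¹' {j}))
  have hrow : ∀ i, ∑' j, γ i j = α (φ k ⁻¹' {i}) := by
    intro i
    rw [← h1, Measure.map_apply measurable_fst (hφ k (measurableSet_singleton i)),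
      ← measure_iUnion]
    · congr 1
      ext p
      simp
    · intro j j' hjj'
      refine Set.disjoint_left.2 fun p hp hp' => hjj' ?_
      exact hp.2.symm.trans hp'.2
    · exact fun j => (hφ k (measurableSet_singleton i)).prod (hφ k (measurableSet_singleton j))
  have hcol : ∀ j, ∑' i, γ i j = β (φ k ⁻¹' {j}) := by
    intro j
    rw [← h2, Measure.map_apply measurable_snd (hφ k (measurableSet_singleton j)),
      ← measure_iUnion]
    · congr 1
      ext p
      simp
    · intro i i' hii'
      refine Set.disjoint_left.2 fun p hp hp' => hii' ?_
      exact hp.1.symm.trans hp'.1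
    · exact fun i => (hφ k (measurableSet_singleton i)).prod (hφ k (measurableSet_singleton j))
  obtain ⟨n, hnle, hnlim⟩ := exists_gridWeight_tendsto γ fun i j => measure_ne_top _ _
  have hsub : ∀ N, IsSubcoupling (fun i => α (φ k ⁻¹' {i})) (fun j => β (φ k ⁻¹' {j}))
      (gridWeight N (n N)) := fun N =>
    ⟨fun i => (ENNReal.tsum_le_tsum fun j => hnle N i j).trans_eq (hrow i),
      fun j => (ENNReal.tsum_le_tsum fun i => hnle N i j).trans_eq (hcol j)⟩
  have hrowlim : ∀ i, Tendsto (fun N => ∑' j, gridWeight N (n N) i j) atTop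
      (𝓝 (α (φ k ⁻¹' {i}))) := fun i => by
    rw [← hrow]
    exact tendsto_tsum_of_le (fun N j => hnle N i j) (by rw [hrow]; exact measure_ne_top _ _)
      fun j => hnlim i j
  have hcollim : ∀ j, Tendsto (fun N => ∑' i, gridWeight N (n N) i j) atTop
      (𝓝 (β (φ k ⁻¹' {j}))) := fun j => by
    rw [← hcol]
    exact tendsto_tsum_of_le (fun N i => hnle N i j) (by rw [hcol]; exact measure_ne_top _ _)
      fun i => hnlim i j
  have hA := tendsto_lintegral_cell_defect α (hφ k)
    (e := fun x => ENNReal.ofReal (dist x o ^ 2)) (by fun_prop) hαo hrowlim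
  have hB := tendsto_lintegral_cell_defect β (hφ k)
    (e := fun x => ENNReal.ofReal (dist x o ^ 2)) (by fun_prop) hβo hcollim
  have hmain : ∀ N, ∑' z : ℕ × ℕ, s z.1 z.2 * gridWeight N (n N) z.1 z.2 ≤
      ENNReal.ofReal (1 + 4 * δ k) * c + ENNReal.ofReal (4 * δ k + 4 * δ k ^ 2) := fun N => by
    calc _ ≤ ∑' z : ℕ × ℕ, s z.1 z.2 * γ z.1 z.2 :=
          ENNReal.tsum_le_tsum fun z => by gcongr; exact hnle N _ _
      _ = ∫⁻ p, s (φ k p.1) (φ k p.2) ∂π := (lintegral_fiber π (hφ k) s).symm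
      _ ≤ _ := lintegral_mono hs'
      _ = _ := by
        rw [lintegral_add_right _ measurable_const, lintegral_const_mul _ (by fun_prop)]
        simp [hc]
  have hlim := ((ENNReal.Tendsto.const_mul hA (Or.inr (by norm_num : (2 : ℝ≥0∞) ≠ ⊤))).const_add
    (ENNReal.ofReal (1 + 4 * δ k) * c + ENNReal.ofReal (4 * δ k + 4 * δ k ^ 2))).add
    (ENNReal.Tendsto.const_mul hB (Or.inr (by norm_num : (2 : ℝ≥0∞) ≠ ⊤)))
  simp only [mul_zero, add_zero] at hlim
  obtain ⟨N, hN⟩ := (hlim.eventually_lt_const hk).exists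
  refine ⟨k, N, n N, hsub N, lt_of_le_of_lt ?_ hN⟩
  refine (lintegral_cellCoupling_le α β (hφ k) (hsub N) (by fun_prop)
    (e := fun x => ENNReal.ofReal (dist x o ^ 2)) (by fun_prop) hs
    (fun p => ofReal_dist_sq_le p.1 p.2 o)).trans ?_
  gcongr
  exact hmain N

/-- The squared Wasserstein distance is convex under mixtures along measurable families. -/
theorem W2sq_bind_le {Ω : Type*} [MeasurableSpace Ω] (l : Measure Ω) [IsProbabilityMeasure l]
    (α β : Kernel Ω X) [IsMarkovKernel α] [IsMarkovKernel β] {g : Ω → ℝ≥0∞} (hg : Measurable g)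
    (hαβ : ∀ ω, W2sq (α ω) (β ω) ≤ g ω)
    (hβ : ∀ ω, ∃ o, ∫⁻ y, ENNReal.ofReal (dist y o ^ 2) ∂(β ω) ≠ ⊤) :
    W2sq (l.bind α) (l.bind β) ≤ ∫⁻ ω, g ω ∂l := by
  have : Nonempty Ω := l.nonempty_of_neZero
  have : Nonempty X := ⟨(hβ (Classical.arbitrary Ω)).choose⟩
  choose φ hφ hφd using fun k : ℕ =>
    exists_measurable_partition X (ε := 1 / ((k : ℝ) + 1)) (by positivity)
  obtain ⟨idx, hidx⟩ := exists_surjective_nat (ℕ × ℕ × ((ℕ × ℕ) →₀ ℕ))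
  let κ : ℕ → Ω → Measure (X × X) := fun m ω =>
    cellCoupling (φ (idx m).1) (gridWeight (idx m).2.1 (idx m).2.2) (α ω) (β ω)
  have hκ : ∀ m, Measurable (κ m) := fun m => measurable_cellCoupling (hφ _) _ α β
  have hcost : Measurable fun p : X × X => ENNReal.ofReal (dist p.1 p.2 ^ 2) := by fun_prop
  refine ENNReal.le_of_forall_pos_le_add fun ε hε _ => ?_
  let good : Ω → ℕ → Prop := fun ω m =>
    IsSubcoupling (fun i => α ω (φ (idx m).1 ⁻¹' {i})) (fun j => β ω (φ (idx m).1 ⁻¹' {j}))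
      (gridWeight (idx m).2.1 (idx m).2.2) ∧
    ∫⁻ p, ENNReal.ofReal (dist p.1 p.2 ^ 2) ∂(κ m ω) ≤ g ω + ε
  have hgood : ∀ ω, ∃ m, good ω m := by
    intro ω
    rcases eq_or_ne (g ω) ⊤ with h | h
    · obtain ⟨m, hm⟩ := hidx (0, 0, 0)
      refine ⟨m, ?_, by simp [h]⟩
      rw [hm]
      constructor <;> simp [gridWeight]
    · obtain ⟨o, ho⟩ := hβ ω
      obtain ⟨k, N, n, hsub, hlt⟩ := exists_cellCoupling_lt hφ hφd o ho
        ((hαβ ω).trans_lt (ENNReal.lt_add_right h (by exact_mod_cast hε.ne' : (ε : ℝ≥0∞) ≠ 0)))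
      obtain ⟨m, hm⟩ := hidx (k, N, n)
      refine ⟨m, ?_⟩
      simp only [good, κ, hm]
      exact ⟨hsub, hlt.le⟩
  have hmeas : ∀ m, MeasurableSet {ω | good ω m} := by
    intro m
    have ha : ∀ i, Measurable fun ω => α ω (φ (idx m).1 ⁻¹' {i}) := fun i =>
      α.measurable_coe (hφ _ (measurableSet_singleton i))
    have hb : ∀ i, Measurable fun ω => β ω (φ (idx m).1 ⁻¹' {i}) := fun i =>
      β.measurable_coe (hφ _ (measurableSet_singleton i))
    have h1 : MeasurableSet {ω | ∀ i, ∑' j, gridWeight (idx m).2.1 (idx m).2.2 i j ≤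
        α ω (φ (idx m).1 ⁻¹' {i})} := by
      rw [Set.ofPred_forall]
      exact MeasurableSet.iInter fun i => measurableSet_le measurable_const (ha i)
    have h2 : MeasurableSet {ω | ∀ j, ∑' i, gridWeight (idx m).2.1 (idx m).2.2 i j ≤
        β ω (φ (idx m).1 ⁻¹' {j})} := by
      rw [Set.ofPred_forall]
      exact MeasurableSet.iInter fun i => measurableSet_le measurable_const (hb i)
    have h3 : MeasurableSet {ω | ∫⁻ p, ENNReal.ofReal (dist p.1 p.2 ^ 2) ∂(κ m ω) ≤ g ω + ε} :=
      measurableSet_le ((Measure.measurable_lintegral hcost).comp (hκ m)) (hg.add_const _)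
    have h4 := (h1.inter h2).inter h3
    refine h4.congr ?_
    ext ω
    rfl
  obtain ⟨sel, hsel, hKspec⟩ : ∃ sel : Ω → ℕ, Measurable sel ∧ ∀ ω, good ω (sel ω) :=
    ⟨fun ω => Nat.find (hgood ω), measurable_find hgood hmeas, fun ω => Nat.find_spec (hgood ω)⟩
  let K : Ω → Measure (X × X) := fun ω => κ (sel ω) ω
  have hK : Measurable K := by
    have h : Measurable (Function.uncurry κ) := measurable_from_prod_countable_right fun m => by
      simpa only [Function.uncurry] using hκ m
    simpa only [Function.comp_def, Function.uncurry, id_eq] using h.comp (hsel.prodMk measurable_id)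
  have hmap : ∀ {f : X × X → X} (_ : Measurable f) {η : Kernel Ω X}
      (_ : ∀ ω, (K ω).map f = η ω), (l.bind K).map f = l.bind η := by
    intro f hf η h
    ext s hs
    rw [Measure.map_apply hf hs, Measure.bind_apply (hf hs) hK.aemeasurable,
      Measure.bind_apply hs η.measurable.aemeasurable]
    refine lintegral_congr fun ω => ?_
    rw [← h, Measure.map_apply hf hs]
  refine (W2sq_le_of_coupling (l.bind K)
    (hmap measurable_fst fun ω => map_fst_cellCoupling _ _ (hφ _) (hKspec ω).1)
    (hmap measurable_snd fun ω => map_snd_cellCoupling _ _ (hφ _) (hKspec ω).1)).trans ?_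
  rw [Measure.lintegral_bind hK.aemeasurable hcost.aemeasurable]
  refine (lintegral_mono fun ω => (hKspec ω).2).trans ?_
  rw [lintegral_add_right _ measurable_const]
  simp

end Selection

section Mixture

theorem W2sq_comm_le {X : Type*} [MetricSpace X] [SecondCountableTopology X] [MeasurableSpace X]
    [BorelSpace X] (a b : Measure X) : W2sq a b ≤ W2sq b a := by
  refine le_iInf₂ fun π hπ => ?_
  refine (W2sq_le_of_coupling (π.map Prod.swap) ?_ ?_).trans_eq ?_
  · rw [Measure.map_map measurable_fst measurable_swap]
    exact hπ.2
  · rw [Measure.map_map measurable_snd measurable_swap]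
    exact hπ.1
  · rw [lintegral_map (by fun_prop) measurable_swap]
    simp [dist_comm]

/-- A transportation cost inequality forces finite second moments. -/
theorem exists_lintegral_dist_sq_ne_top {X : Type*} [MetricSpace X] [SecondCountableTopology X]
    [MeasurableSpace X] [BorelSpace X] (p : Measure X) [IsProbabilityMeasure p] {C : ℝ≥0∞}
    (hC : C ≠ ⊤)
    (h : ∀ Q : Measure X, IsProbabilityMeasure Q → W2sq Q p ≤ C * relEntropy Q p) :
    ∃ o, ∫⁻ y, ENNReal.ofReal (dist y o ^ 2) ∂p ≠ ⊤ := by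
  obtain ⟨o⟩ : Nonempty X := p.nonempty_of_neZero
  refine ⟨o, ?_⟩
  obtain ⟨R, hR⟩ : ∃ R : ℕ, p (Metric.ball o R) ≠ 0 := by
    by_contra! hcon
    have := measure_iUnion_null hcon
    rw [Metric.iUnion_ball_nat, measure_univ] at this
    exact one_ne_zero this
  set B := Metric.ball o (R : ℝ) with hB
  have hBm : MeasurableSet B := Metric.isOpen_ball.measurableSet
  let D : X → ℝ≥0∞ := B.indicator fun _ => (p B)⁻¹
  have hD : Measurable D := measurable_const.indicator hBm
  have hinv : (p B)⁻¹ ≠ ⊤ := ENNReal.inv_ne_top.2 hR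
  have hQ : IsProbabilityMeasure (p.withDensity D) := ⟨by
    rw [withDensity_apply _ .univ, Measure.restrict_univ, lintegral_indicator hBm,
      setLIntegral_const, ENNReal.inv_mul_cancel hR (measure_ne_top _ _)]⟩
  have hH : relEntropy (p.withDensity D) p ≠ ⊤ := by
    rw [relEntropy_withDensity p hD]
    refine ne_top_of_le_ne_top ?_ (lintegral_mono (g := fun _ =>
      ENNReal.ofReal (klFun ((p B)⁻¹).toReal) + ENNReal.ofReal (klFun 0)) fun x => ?_)
    · simp
    · by_cases hx : x ∈ B
      · simp [D, hx]
      · simp [D, hx]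
  have hmom : ∫⁻ y, ENNReal.ofReal (dist y o ^ 2) ∂(p.withDensity D) ≠ ⊤ := by
    rw [lintegral_withDensity_eq_lintegral_mul _ hD (by fun_prop)]
    refine ne_top_of_le_ne_top ?_ (lintegral_mono (g := fun _ =>
      (p B)⁻¹ * ENNReal.ofReal ((R : ℝ) ^ 2)) fun x => ?_)
    · simpa using ENNReal.mul_ne_top hinv (by simp)
    · by_cases hx : x ∈ B
      · have : dist x o ≤ R := (Metric.mem_ball.1 hx).le
        simp only [D, Pi.mul_apply, Set.indicator_of_mem hx]
        gcongr
      · simp [D, hx]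
  exact lintegral_dist_sq_ne_top_of_W2sq (((W2sq_comm_le _ _).trans (h _ hQ)).trans_lt
    (ENNReal.mul_lt_top hC.lt_top hH.lt_top)) o hmom

theorem W2sq_bind_bind_le {E : Type*} [MetricSpace E] [SecondCountableTopology E]
    [MeasurableSpace E] [BorelSpace E] {X : Type*} [MetricSpace X] [SecondCountableTopology X]
    [MeasurableSpace X] [BorelSpace X] (κ : Kernel E X) [IsMarkovKernel κ] {C : ℝ≥0∞}
    (hC0 : C ≠ 0) (hC : C ≠ ⊤)
    (hLip : ∀ x y, W2sq (κ x) (κ y) ≤ C * ENNReal.ofReal (dist x y ^ 2))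
    (hmom : ∀ x, ∃ o, ∫⁻ y, ENNReal.ofReal (dist y o ^ 2) ∂(κ x) ≠ ⊤)
    (ν μ : Measure E) [IsProbabilityMeasure ν] :
    W2sq (ν.bind κ) (μ.bind κ) ≤ C * W2sq ν μ := by
  conv_rhs => rw [W2sq]
  simp_rw [ENNReal.mul_iInf_of_ne hC0 hC]
  refine le_iInf₂ fun π hπ => ?_
  have hprob : IsProbabilityMeasure π := by
    have : IsProbabilityMeasure (π.map Prod.fst) := by rw [hπ.1]; infer_instance
    exact Measure.isProbabilityMeasure_of_map (μ := π) Prod.fst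
  have hbind : ∀ {f : E × E → E} (hf : Measurable f),
      (π.map f).bind κ = π.bind (κ.comap f hf) := fun {f} hf => by
    ext s hs
    rw [Measure.bind_apply hs κ.measurable.aemeasurable,
      Measure.bind_apply hs (κ.comap f hf).measurable.aemeasurable,
      lintegral_map (κ.measurable_coe hs) hf]
    rfl
  rw [← hπ.1, ← hπ.2, hbind measurable_fst, hbind measurable_snd]
  rw [← lintegral_const_mul' _ _ hC]
  exact W2sq_bind_le π _ _ (by fun_prop) (fun ω => hLip ω.1 ω.2) fun ω => hmom ω.2

theorem exists_disintegration {E X : Type*} [MeasurableSpace E] [MeasurableSpace X]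
    (κ : Kernel E X) [IsMarkovKernel κ] (μ : Measure E) [IsProbabilityMeasure μ]
    (Q : Measure X) [IsProbabilityMeasure Q] (hQ : Q ≪ μ.bind κ) :
    ∃ (ν : Measure E) (η : Kernel E X), IsProbabilityMeasure ν ∧ IsMarkovKernel η ∧
      ν.bind η = Q ∧ relEntropy ν μ ≤ relEntropy Q (μ.bind κ) ∧
      Measurable (fun x => relEntropy (η x) (κ x)) ∧
      ∫⁻ x, relEntropy (η x) (κ x) ∂ν ≤ relEntropy Q (μ.bind κ) := by
  set pm := μ.bind κ with hpm
  have hpmp : IsProbabilityMeasure pm := by rw [hpm]; infer_instance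
  let F : X → ℝ := fun ξ => (Q.rnDeriv pm ξ).toReal
  have hF : Measurable F := (Measure.measurable_rnDeriv Q pm).ennreal_toReal
  have hF0 : ∀ ξ, 0 ≤ F ξ := fun _ => ENNReal.toReal_nonneg
  have hFm : Measurable fun ξ => ENNReal.ofReal (F ξ) := by fun_prop
  have hQF : pm.withDensity (fun ξ => ENNReal.ofReal (F ξ)) = Q := by
    conv_rhs => rw [← Measure.withDensity_rnDeriv_eq Q pm hQ]
    refine withDensity_congr_ae ?_
    filter_upwards [Measure.rnDeriv_lt_top Q pm] with ξ hξ
    exact ENNReal.ofReal_toReal hξ.ne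
  have hkl : Measurable fun ξ => ENNReal.ofReal (klFun (F ξ)) :=
    (measurable_klFun.comp hF).ennreal_ofReal
  have hH : relEntropy Q pm = ∫⁻ x, ∫⁻ ξ, ENNReal.ofReal (klFun (F ξ)) ∂(κ x) ∂μ := by
    conv_lhs => rw [← hQF, relEntropy_withDensity pm hFm]
    rw [hpm, Measure.lintegral_bind κ.measurable.aemeasurable
      (by simpa only [ENNReal.toReal_ofReal (hF0 _)] using hkl.aemeasurable)]
    simp only [ENNReal.toReal_ofReal (hF0 _)]
  let g : E → ℝ≥0∞ := fun x => ∫⁻ ξ, ENNReal.ofReal (F ξ) ∂(κ x)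
  have hg : Measurable g := hFm.lintegral_kernel
  have hgint : ∫⁻ x, g x ∂μ = 1 := by
    have : Q Set.univ = 1 := measure_univ
    rw [← hQF, withDensity_apply _ .univ, Measure.restrict_univ, hpm,
      Measure.lintegral_bind κ.measurable.aemeasurable hFm.aemeasurable] at this
    exact this
  have hgtop : ∀ᵐ x ∂μ, g x < ⊤ := ae_lt_top hg (by rw [hgint]; exact one_ne_top)
  let D : E → X → ℝ≥0∞ := fun x ξ =>
    if g x ≠ 0 ∧ g x ≠ ⊤ then ENNReal.ofReal (F ξ) / g x else 1
  have hDm : Measurable (Function.uncurry D) := by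
    refine Measurable.ite ?_ ?_ measurable_const
    · have hs : MeasurableSet {x | g x ≠ 0 ∧ g x ≠ ⊤} :=
        ((measurableSet_eq_fun hg measurable_const).compl).inter
          ((measurableSet_eq_fun hg measurable_const).compl)
      exact measurable_fst hs
    · exact (hFm.comp measurable_snd).div (hg.comp measurable_fst)
  have hDx : ∀ x, Measurable (D x) := fun x => hDm.of_uncurry_left
  have hη : ∀ x, κ.withDensity D x = (κ x).withDensity (D x) :=
    fun x => Kernel.withDensity_apply κ hDm x
  have hent : ∀ x, relEntropy (κ.withDensity D x) (κ x) =
      ∫⁻ ξ, ENNReal.ofReal (klFun (D x ξ).toReal) ∂(κ x) := fun x => by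
    rw [hη, relEntropy_withDensity _ (hDx x)]
  have hentm : Measurable fun x => relEntropy (κ.withDensity D x) (κ x) := by
    simp_rw [hent]
    exact Measurable.lintegral_kernel_prod_right
      ((measurable_klFun.comp hDm.ennreal_toReal).ennreal_ofReal)
  refine ⟨μ.withDensity g, κ.withDensity D, ⟨?_⟩, ⟨fun x => ⟨?_⟩⟩, ?_, ?_, hentm, ?_⟩
  · rw [withDensity_apply _ .univ, Measure.restrict_univ, hgint]
  · rw [hη, withDensity_apply _ .univ, Measure.restrict_univ]
    by_cases h : g x ≠ 0 ∧ g x ≠ ⊤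
    · simp only [D, if_pos h, div_eq_mul_inv]
      rw [lintegral_mul_const _ hFm]
      exact ENNReal.mul_inv_cancel h.1 h.2
    · simp [D, if_neg h]
  · ext s hs
    conv_rhs => rw [← hQF, withDensity_apply _ hs, ← lintegral_indicator hs, hpm,
      Measure.lintegral_bind κ.measurable.aemeasurable (hFm.indicator hs).aemeasurable]
    rw [Measure.bind_apply hs (Kernel.measurable _).aemeasurable,
      lintegral_withDensity_eq_lintegral_mul _ hg (Kernel.measurable_coe _ hs)]
    refine lintegral_congr_ae ?_
    filter_upwards [hgtop] with x hx
    rw [lintegral_indicator hs, Pi.mul_apply, hη, withDensity_apply _ hs]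
    by_cases h : g x = 0
    · rw [h, zero_mul]
      refine (le_antisymm ?_ zero_le).symm
      exact (setLIntegral_le_lintegral s _).trans h.le
    · simp only [D, if_pos (And.intro h hx.ne), div_eq_mul_inv]
      rw [lintegral_mul_const _ hFm, mul_comm, mul_assoc, ENNReal.inv_mul_cancel h hx.ne, mul_one]
  · rw [relEntropy_withDensity μ hg, hH]
    refine lintegral_mono_ae ?_
    filter_upwards [hgtop] with x hx
    exact le_self_add.trans (klFun_lintegral_add_le (κ x) hF hF0 rfl hx.ne)
  · rw [lintegral_withDensity_eq_lintegral_mul _ hg hentm, hH]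
    refine lintegral_mono_ae ?_
    filter_upwards [hgtop] with x hx
    rw [Pi.mul_apply, hent]
    by_cases h : g x = 0
    · simp [h]
    · refine le_trans (le_of_eq ?_)
        (le_add_self.trans (klFun_lintegral_add_le (κ x) hF hF0 rfl hx.ne))
      simp only [D, if_pos (And.intro h hx.ne), ENNReal.toReal_div,
        ENNReal.toReal_ofReal (hF0 _)]
      rfl

/-- Transportation cost inequalities are stable under mixtures along a Wasserstein-Lipschitz
kernel. -/
theorem W2sq_le_relEntropy_bind {E : Type*} [MetricSpace E] [SecondCountableTopology E]
    [MeasurableSpace E] [BorelSpace E] {X : Type*} [MetricSpace X] [SecondCountableTopology X]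
    [MeasurableSpace X] [BorelSpace X] [StandardBorelSpace X] (κ : Kernel E X) [IsMarkovKernel κ]
    {c₀ c₁ c₂ : ℝ} (hc₀ : 0 < c₀) (hc₁ : 0 < c₁) (hc₂ : 0 < c₂)
    (hκ : ∀ x : E, ∀ Q : Measure X, IsProbabilityMeasure Q →
      W2sq Q (κ x) ≤ ENNReal.ofReal c₁ * relEntropy Q (κ x))
    (hLip : ∀ x y : E,
      W2sq (κ x) (κ y) ≤ ENNReal.ofReal c₂ * ENNReal.ofReal (dist x y ^ 2))
    (μ : Measure E) [IsProbabilityMeasure μ]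
    (hμ : ∀ ν : Measure E, IsProbabilityMeasure ν →
      W2sq ν μ ≤ ENNReal.ofReal c₀ * relEntropy ν μ)
    (Q : Measure X) [IsProbabilityMeasure Q] :
    W2sq Q (μ.bind κ) ≤
      ENNReal.ofReal ((Real.sqrt c₁ + Real.sqrt (c₀ * c₂)) ^ 2) * relEntropy Q (μ.bind κ) := by
  have hspos : 0 < Real.sqrt c₁ + Real.sqrt (c₀ * c₂) := by positivity
  by_cases hac : Q ≪ μ.bind κ
  swap
  · rw [relEntropy, if_neg hac, ENNReal.mul_top (by positivity)]
    exact le_top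
  obtain ⟨ν, η, hν, hη, hQ, hνμ, hm, hηκ⟩ := exists_disintegration κ μ Q hac
  set H := relEntropy Q (μ.bind κ) with hHdef
  have hmom : ∀ x, ∃ o, ∫⁻ y, ENNReal.ofReal (dist y o ^ 2) ∂(κ x) ≠ ⊤ := fun x =>
    exists_lintegral_dist_sq_ne_top (κ x) ENNReal.ofReal_ne_top (hκ x)
  have h1 : W2sq Q (ν.bind κ) ≤ ENNReal.ofReal c₁ * H := by
    conv_lhs => rw [← hQ]
    refine (W2sq_bind_le ν η κ (hm.const_mul (ENNReal.ofReal c₁))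
      (fun x => hκ x (η x) inferInstance) hmom).trans ?_
    rw [lintegral_const_mul _ hm]
    gcongr
  have h2 : W2sq (ν.bind κ) (μ.bind κ) ≤ ENNReal.ofReal (c₀ * c₂) * H := by
    refine (W2sq_bind_bind_le κ (ENNReal.ofReal_pos.2 hc₂).ne' ENNReal.ofReal_ne_top hLip hmom
      ν μ).trans ?_
    rw [mul_comm c₀, ENNReal.ofReal_mul hc₂.le, mul_assoc]
    gcongr
    exact (hμ ν hν).trans (by gcongr)
  have hsqrt : ∀ {c : ℝ}, 0 ≤ c → (ENNReal.ofReal c * H) ^ (1 / 2 : ℝ) =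
      ENNReal.ofReal (Real.sqrt c) * H ^ (1 / 2 : ℝ) := fun {c} hc => by
    rw [ENNReal.mul_rpow_of_nonneg _ _ (by norm_num),
      ENNReal.ofReal_rpow_of_nonneg hc (by norm_num), Real.sqrt_eq_rpow]
  have h3 : W2sq Q (μ.bind κ) ^ (1 / 2 : ℝ) ≤
      ENNReal.ofReal (Real.sqrt c₁ + Real.sqrt (c₀ * c₂)) * H ^ (1 / 2 : ℝ) := by
    refine (W2sq_rpow_triangle Q (ν.bind κ) (μ.bind κ)).trans ?_
    rw [ENNReal.ofReal_add (Real.sqrt_nonneg _) (Real.sqrt_nonneg _), add_mul,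
      ← hsqrt hc₁.le, ← hsqrt (by positivity)]
    gcongr
  have h4 := ENNReal.rpow_le_rpow h3 (by norm_num : (0 : ℝ) ≤ 2)
  rw [ENNReal.mul_rpow_of_nonneg _ _ (by norm_num), ← ENNReal.rpow_mul, ← ENNReal.rpow_mul] at h4
  norm_num at h4
  rwa [← ENNReal.ofReal_pow hspos.le] at h4

end Mixture

/-- **Theorem 2.1 (first part).** If each `P^x` satisfies a `T₂` transportation cost
inequality with constant `c₁`, the map `x ↦ P^x` is Lipschitz in `W₂,T` in the sense
`W_{2,T}(P^x,P^y)² ≤ c₂ ρ(x,y)²`, and the initial distribution `μ` satisfies a `T₂`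
inequality with constant `c₀`, then the law `P^μ = ∫ P^x μ(dx)` on the free path space
satisfies `W_{2,T}(Q,P^μ)² ≤ (√c₁ + √(c₀c₂))² H(Q|P^μ)` for all `Q ∈ P(E_T)`. -/
theorem tci_free_path_space
    {E : Type*} [MetricSpace E] [PolishSpace E] [MeasurableSpace E] [BorelSpace E]
    (T : ℝ) (hT : 0 < T)
    (P : E → Measure (PathSpace E T))
    (hPmeas : Measurable P)
    (hPprob : ∀ x, IsProbabilityMeasure (P x))
    (hP0 : ∀ x : E,
      (P x).map (fun ξ : PathSpace E T => ξ ⟨0, Set.left_mem_Icc.mpr hT.le⟩) = Measure.dirac x)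
    (c₀ c₁ c₂ : ℝ) (hc₀ : 0 < c₀) (hc₁ : 0 < c₁) (hc₂ : 0 < c₂)
    (hTCIx : ∀ x : E, ∀ Q : Measure (PathSpace E T), IsProbabilityMeasure Q →
      W2sq Q (P x) ≤ ENNReal.ofReal c₁ * relEntropy Q (P x))
    (hLip : ∀ x y : E,
      W2sq (P x) (P y) ≤ ENNReal.ofReal c₂ * ENNReal.ofReal (dist x y ^ 2))
    (μ : Measure E) [IsProbabilityMeasure μ]
    (hTCIμ : ∀ ν : Measure E, IsProbabilityMeasure ν →
      W2sq ν μ ≤ ENNReal.ofReal c₀ * relEntropy ν μ) :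
    ∀ Q : Measure (PathSpace E T), IsProbabilityMeasure Q →
      W2sq Q (μ.bind P) ≤
        ENNReal.ofReal ((Real.sqrt c₁ + Real.sqrt (c₀ * c₂)) ^ 2)
          * relEntropy Q (μ.bind P) := by
  intro Q hQ
  have : PolishSpace (PathSpace E T) := polishSpace_continuousMap
  let κ : Kernel E (PathSpace E T) := ⟨P, hPmeas⟩
  have : IsMarkovKernel κ := ⟨hPprob⟩
  exact W2sq_le_relEntropy_bind κ hc₀ hc₁ hc₂ hTCIx hLip μ hTCIμ Q
end

section
/- Let (E,ρ) be a Polish metric space, T>0, and let x↦P^x be a measurable family of probability measures on the free path space E_T = C([0,T];E) such that the pushforward of P^x under the evaluation map u₀(ξ)=ξ₀ equals δ_x for every x∈E; for μ∈P(E) set P^μ = ∫_E P^x μ(dx). If for some constant C∈(0,∞) the inequality W_{2,T}(Q,P^μ)² ≤ C·H(Q|P^μ) holds for every probability measure Q on E_T, then W₂(ν,μ)² ≤ C·H(ν|μ) holds for every probability measure ν on E. -/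
open MeasureTheory ENNReal
open scoped Classical

/-- A 1-Lipschitz measurable map does not increase the Wasserstein distance. -/
lemma W2sq_map_le {X Y : Type*} [MeasurableSpace X] [MetricSpace X]
    [MeasurableSpace Y] [MetricSpace Y] [OpensMeasurableSpace Y] [SecondCountableTopology Y]
    {u : X → Y} (hu : Measurable u) (hdist : ∀ x y, dist (u x) (u y) ≤ dist x y)
    (μ ν : Measure X) : W2sq (μ.map u) (ν.map u) ≤ W2sq μ ν := by
  refine le_iInf₂ fun π hπ => ?_
  have huu : Measurable (Prod.map u u) := hu.prodMap hu
  have hfst : (π.map (Prod.map u u)).map Prod.fst = μ.map u := by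
    rw [Measure.map_map measurable_fst huu, ← hπ.1, Measure.map_map hu measurable_fst]
    rfl
  have hsnd : (π.map (Prod.map u u)).map Prod.snd = ν.map u := by
    rw [Measure.map_map measurable_snd huu, ← hπ.2, Measure.map_map hu measurable_snd]
    rfl
  refine (iInf₂_le (π.map (Prod.map u u)) ⟨hfst, hsnd⟩).trans ?_
  rw [lintegral_map (by fun_prop) huu]
  exact lintegral_mono fun p => ENNReal.ofReal_le_ofReal
    (pow_le_pow_left₀ dist_nonneg (hdist p.1 p.2) 2)

/-- Pushing forward by `u` turns the density `f ∘ u` into the density `f`. -/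
lemma map_withDensity_comp {X Y : Type*} [MeasurableSpace X] [MeasurableSpace Y]
    {u : X → Y} (hu : Measurable u) {f : Y → ℝ≥0∞} (hf : Measurable f) (μ : Measure X) :
    (μ.withDensity (f ∘ u)).map u = (μ.map u).withDensity f := by
  ext s hs
  rw [Measure.map_apply hu hs, withDensity_apply _ (hu hs), withDensity_apply _ hs,
    setLIntegral_map hs hf hu]
  rfl

/-- Lifting a density along a measurable map preserves the relative entropy. -/
lemma relEntropy_withDensity_rnDeriv_comp {X Y : Type*} [MeasurableSpace X] [MeasurableSpace Y]
    {u : X → Y} (hu : Measurable u) (μ : Measure X) [SigmaFinite μ] {ν : Measure Y}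
    (hν : ν ≪ μ.map u) :
    relEntropy (μ.withDensity (ν.rnDeriv (μ.map u) ∘ u)) μ = relEntropy ν (μ.map u) := by
  have hf := Measure.measurable_rnDeriv ν (μ.map u)
  rw [relEntropy, relEntropy, if_pos (withDensity_absolutelyContinuous _ _), if_pos hν,
    lintegral_map (by fun_prop) hu]
  refine lintegral_congr_ae ?_
  filter_upwards [Measure.rnDeriv_withDensity μ (hf.comp hu)] with x hx
  rw [hx]
  rfl

/-- If each `P y` is carried by the fibre of `u` over `y`, then mixing and
pushing forward by `u` returns the mixing measure. -/
lemma map_bind_eq_self {X Y : Type*} [MeasurableSpace X] [MeasurableSpace Y]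
    {u : X → Y} (hu : Measurable u) {P : Y → Measure X} (hP : Measurable P)
    (h : ∀ y, (P y).map u = Measure.dirac y) (μ : Measure Y) : (μ.bind P).map u = μ := by
  ext s hs
  rw [Measure.map_apply hu hs, Measure.bind_apply (hu hs) hP.aemeasurable]
  simp_rw [← Measure.map_apply hu hs, h, Measure.dirac_apply' _ hs]
  exact lintegral_indicator_one hs

/-- **Theorem 2.1 (second part).** If the law `P^μ = ∫ P^x μ(dx)` on the free path
space satisfies `W_{2,T}(Q,P^μ)² ≤ C H(Q|P^μ)` for all `Q ∈ P(E_T)`, then the initial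
distribution `μ` satisfies `W₂(ν,μ)² ≤ C H(ν|μ)` for all `ν ∈ P(E)`. -/
theorem tci_free_path_space_converse
    {E : Type*} [MetricSpace E] [PolishSpace E] [MeasurableSpace E] [BorelSpace E]
    (T : ℝ) (hT : 0 < T)
    (P : E → Measure (PathSpace E T))
    (hPmeas : Measurable P)
    (hPprob : ∀ x, IsProbabilityMeasure (P x))
    (hP0 : ∀ x : E,
      (P x).map (fun ξ : PathSpace E T => ξ ⟨0, Set.left_mem_Icc.mpr hT.le⟩) = Measure.dirac x)
    (μ : Measure E) [IsProbabilityMeasure μ]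
    (C : ℝ) (hC : 0 < C)
    (hTCI : ∀ Q : Measure (PathSpace E T), IsProbabilityMeasure Q →
      W2sq Q (μ.bind P) ≤ ENNReal.ofReal C * relEntropy Q (μ.bind P)) :
    ∀ ν : Measure E, IsProbabilityMeasure ν →
      W2sq ν μ ≤ ENNReal.ofReal C * relEntropy ν μ := by
  intro ν hν
  by_cases hac : ν ≪ μ
  swap
  · rw [relEntropy, if_neg hac, ENNReal.mul_top (by simpa using hC)]
    exact le_top
  set u : PathSpace E T → E := fun ξ => ξ ⟨0, Set.left_mem_Icc.mpr hT.le⟩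
  have hu : Measurable u := (continuous_eval_const _).measurable
  have hmap : (μ.bind P).map u = μ := map_bind_eq_self hu hPmeas hP0 μ
  have hprob : IsProbabilityMeasure (μ.bind P) :=
    isProbabilityMeasure_bind hPmeas.aemeasurable (ae_of_all _ hPprob)
  set Q := (μ.bind P).withDensity (ν.rnDeriv μ ∘ u)
  have hQmap : Q.map u = ν := by
    rw [map_withDensity_comp hu (Measure.measurable_rnDeriv ν μ), hmap,
      Measure.withDensity_rnDeriv_eq _ _ hac]
  have hQ : IsProbabilityMeasure Q := by
    rw [← hQmap] at hν
    exact Measure.isProbabilityMeasure_of_map u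
  calc W2sq ν μ = W2sq (Q.map u) ((μ.bind P).map u) := by rw [hQmap, hmap]
    _ ≤ W2sq Q (μ.bind P) := W2sq_map_le hu (fun ξ η => ContinuousMap.dist_apply_le_dist _) _ _
    _ ≤ ENNReal.ofReal C * relEntropy Q (μ.bind P) := hTCI Q hQ
    _ = ENNReal.ofReal C * relEntropy ν μ := by
      have hH := relEntropy_withDensity_rnDeriv_comp hu (μ.bind P) (hmap.symm ▸ hac)
      rw [hmap] at hH
      rw [hH]
end

section
/- Let p_t(x,y) = 2 Σ_{n=1}^∞ e^{-n²π²t/2} sin(nπx) sin(nπy), t>0, x,y∈[0,1], be the Dirichlet heat kernel generated by (1/2)Δ = (1/2) d²/dx² on [0,1]. Then for every t>0, sup_{x∈[0,1]} ∫₀^t ∫₀¹ p_{t-s}(x,y)² dy ds ≤ √(2t)/√π. -/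
open MeasureTheory

/-- The Dirichlet heat kernel generated by `(1/2)Δ = (1/2) d²/dx²` on `[0,1]`:
`p_t(x,y) = 2 Σ_{n=1}^∞ e^{-n²π²t/2} sin(nπx) sin(nπy)`. -/
noncomputable def dirichletHeatKernel (t x y : ℝ) : ℝ :=
  2 * ∑' n : ℕ, Real.exp (-((n + 1 : ℝ) ^ 2 * Real.pi ^ 2 * t) / 2)
      * Real.sin ((n + 1 : ℝ) * Real.pi * x) * Real.sin ((n + 1 : ℝ) * Real.pi * y)

open Real in
theorem integral_cos_intCast_mul_pi {k : ℤ} (hk : k ≠ 0) :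
    ∫ y in (0:ℝ)..1, cos (k * π * y) = 0 := by
  have hk' : (k : ℝ) * π ≠ 0 := mul_ne_zero (by exact_mod_cast hk) pi_ne_zero
  rw [intervalIntegral.integral_comp_mul_left (fun z => cos z) hk']
  simp [sin_int_mul_pi]

open Real in
theorem integral_sin_mul_sin_natCast_succ (n m : ℕ) :
    ∫ y in (0:ℝ)..1, sin ((n + 1 : ℝ) * π * y) * sin ((m + 1 : ℝ) * π * y)
      = if n = m then 1 / 2 else 0 := by
  have product_to_sum (y : ℝ) : sin ((n + 1 : ℝ) * π * y) * sin ((m + 1 : ℝ) * π * y)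
      = (cos (((n - m : ℤ) : ℝ) * π * y) - cos (((n + m + 2 : ℤ) : ℝ) * π * y)) / 2 := by
    have hsub : ((n - m : ℤ) : ℝ) * π * y = (n + 1 : ℝ) * π * y - (m + 1 : ℝ) * π * y := by
      push_cast; ring
    have hadd : ((n + m + 2 : ℤ) : ℝ) * π * y = (n + 1 : ℝ) * π * y + (m + 1 : ℝ) * π * y := by
      push_cast; ring
    rw [hsub, hadd, cos_sub, cos_add]
    ring
  simp_rw [product_to_sum]
  rw [intervalIntegral.integral_div, intervalIntegral.integral_sub
    (by apply Continuous.intervalIntegrable; fun_prop)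
    (by apply Continuous.intervalIntegrable; fun_prop),
    integral_cos_intCast_mul_pi (k := n + m + 2) (by omega)]
  split_ifs with h
  · simp [h]
  · rw [integral_cos_intCast_mul_pi (by omega)]
    simp

open Real in
theorem abs_mul_sin_le (a z : ℝ) : |a * sin z| ≤ |a| := by
  rw [abs_mul]
  exact mul_le_of_le_one_right (abs_nonneg a) (abs_sin_le_one z)

open Real in
theorem hasSum_integral_sineSeries_mul {c : ℕ → ℝ} (hc : Summable fun n => |c n|)
    {g : ℝ → ℝ} (hg : Continuous g) {C : ℝ} (hgC : ∀ y, |g y| ≤ C) :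
    HasSum (fun n : ℕ => c n * ∫ y in (0:ℝ)..1, sin ((n + 1 : ℝ) * π * y) * g y)
      (∫ y in (0:ℝ)..1, (∑' n : ℕ, c n * sin ((n + 1 : ℝ) * π * y)) * g y) := by
  simp_rw [← intervalIntegral.integral_const_mul, ← mul_assoc]
  refine intervalIntegral.hasSum_integral_of_dominated_convergence (fun n _ => |c n| * C)
    (fun n => (by fun_prop : Continuous _).aestronglyMeasurable) (fun n => ?_) ?_ ?_ ?_
  · refine .of_forall fun y _ => ?_
    rw [norm_mul]
    exact mul_le_mul (abs_mul_sin_le _ _) (hgC y) (norm_nonneg _) (abs_nonneg _)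
  · exact .of_forall fun y _ => hc.mul_right C
  · simp
  · exact .of_forall fun y _ =>
      (Summable.of_norm_bounded hc fun n => abs_mul_sin_le _ _).hasSum.mul_right (g y)

open Real in
/-- Parseval's identity for absolutely summable sine series. -/
theorem integral_sineSeries_sq {c : ℕ → ℝ} (hc : Summable fun n => |c n|) :
    ∫ y in (0:ℝ)..1, (∑' n : ℕ, c n * sin ((n + 1 : ℝ) * π * y)) ^ 2
      = ∑' n : ℕ, c n ^ 2 / 2 := by
  have hcont : Continuous fun y : ℝ => ∑' n : ℕ, c n * sin ((n + 1 : ℝ) * π * y) :=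
    continuous_tsum (fun n => by fun_prop) hc fun n y => abs_mul_sin_le _ _
  have hbound (y : ℝ) : |∑' n : ℕ, c n * sin ((n + 1 : ℝ) * π * y)| ≤ ∑' n, |c n| :=
    tsum_of_norm_bounded (f := fun n : ℕ => c n * sin ((n + 1 : ℝ) * π * y)) hc.hasSum
      fun n => abs_mul_sin_le _ _
  have hcoeff (m : ℕ) : ∫ y in (0:ℝ)..1,
      sin ((m + 1 : ℝ) * π * y) * ∑' n : ℕ, c n * sin ((n + 1 : ℝ) * π * y) = c m / 2 := by
    have h := hasSum_integral_sineSeries_mul hc (g := fun y => sin ((m + 1 : ℝ) * π * y))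
      (by fun_prop) (fun y => abs_sin_le_one _)
    simp_rw [integral_sin_mul_sin_natCast_succ, mul_ite, mul_zero] at h
    simp_rw [mul_comm (sin ((m + 1 : ℝ) * π * _))]
    rw [← h.tsum_eq, tsum_ite_eq]
    ring
  have h := hasSum_integral_sineSeries_mul hc hcont hbound
  simp_rw [hcoeff, ← pow_two] at h
  rw [← h.tsum_eq]
  congr 1 with n
  ring

open Real HurwitzZeta in
theorem evenKernel_zero_sub_one_le {x u : ℝ} (hx : x ∈ Set.Icc (0:ℝ) 1) (hu : 0 < u) :
    evenKernel 0 u - 1 ≤ evenKernel x u := by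
  have h0 := hasSum_nat_cosKernel₀ 0 hu
  have hx' := (hasSum_int_evenKernel x hu).nat_add_neg_add_one
  have hzero : cosKernel ((0:ℝ) : UnitAddCircle) u = evenKernel 0 u := by
    rw [evenKernel_eq_cosKernel_of_zero]; rfl
  rw [hzero] at h0
  refine hasSum_le (fun n => ?_) h0 hx'
  have hn : (0:ℝ) ≤ n := n.cast_nonneg
  have hright : rexp (-π * (n + 1) ^ 2 * u) ≤ rexp (-π * (n + x) ^ 2 * u) := by
    simp only [neg_mul, exp_le_exp, neg_le_neg_iff]
    have := hx.1
    have := hx.2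
    gcongr
  have hleft : rexp (-π * (n + 1) ^ 2 * u) ≤ rexp (-π * (-(n + 1) + x) ^ 2 * u) := by
    simp only [neg_mul, exp_le_exp, neg_le_neg_iff]
    have : (-(n + 1 : ℝ) + x) ^ 2 ≤ (n + 1 : ℝ) ^ 2 := by
      nlinarith [hx.1, hx.2]
    gcongr
  push_cast
  simp only [mul_zero, zero_mul, cos_zero, mul_one]
  linarith

open Real HurwitzZeta in
/-- The on-diagonal Dirichlet heat kernel is dominated by the Gaussian kernel of the line. -/
theorem tsum_exp_mul_sin_sq_le {x τ : ℝ} (hx : x ∈ Set.Icc (0:ℝ) 1) (hτ : 0 < τ) :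
    2 * ∑' n : ℕ, rexp (-((n + 1 : ℝ) ^ 2 * π ^ 2 * τ)) * sin ((n + 1 : ℝ) * π * x) ^ 2
      ≤ τ ^ (-(1 / 2) : ℝ) / (2 * √π) := by
  have hv : 0 < π * τ := by positivity
  have hu : 0 < 1 / (π * τ) := by positivity
  have hsum := ((hasSum_nat_cosKernel₀ 0 hv).sub (hasSum_nat_cosKernel₀ x hv)).div_const 2
  have hterm (n : ℕ) : (2 * cos (2 * π * 0 * (n + 1)) * rexp (-π * (n + 1) ^ 2 * (π * τ))
      - 2 * cos (2 * π * x * (n + 1)) * rexp (-π * (n + 1) ^ 2 * (π * τ))) / 2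
      = 2 * (rexp (-((n + 1 : ℝ) ^ 2 * π ^ 2 * τ)) * sin ((n + 1 : ℝ) * π * x) ^ 2) := by
    rw [show 2 * π * x * (n + 1 : ℝ) = 2 * ((n + 1 : ℝ) * π * x) by ring, cos_two_mul, cos_sq',
      show -π * (n + 1 : ℝ) ^ 2 * (π * τ) = -((n + 1 : ℝ) ^ 2 * π ^ 2 * τ) by ring]
    simp only [mul_zero, zero_mul, cos_zero]
    ring
  simp_rw [hterm] at hsum
  rw [← tsum_mul_left, hsum.tsum_eq]
  have hle := evenKernel_zero_sub_one_le hx hu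
  rw [evenKernel_functional_equation, evenKernel_functional_equation, one_div_one_div] at hle
  have hw : (1 / (π * τ)) ^ (1 / 2 : ℝ) = τ ^ (-(1 / 2) : ℝ) / √π := by
    rw [one_div (π * τ), inv_rpow hv.le, mul_rpow pi_pos.le hτ.le, rpow_neg hτ.le, sqrt_eq_rpow,
      mul_inv]
    field_simp
  rw [hw] at hle
  have hpos : 0 < τ ^ (-(1 / 2) : ℝ) / √π := by positivity
  generalize hq : τ ^ (-(1 / 2) : ℝ) / √π = q at *
  rw [show τ ^ (-(1 / 2) : ℝ) / (2 * √π) = q / 2 by rw [← hq]; ring]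
  have hdiff : 1 / q * (cosKernel (0 : UnitAddCircle) (π * τ) - cosKernel x (π * τ)) ≤ 1 := by
    linarith
  rw [one_div, inv_mul_le_iff₀ hpos] at hdiff
  change (cosKernel ((0:ℝ) : UnitAddCircle) (π * τ) - 1 - (cosKernel x (π * τ) - 1)) / 2 ≤ q / 2
  rw [QuotientAddGroup.mk_zero]
  linarith

open Real in
theorem summable_exp_neg_sq_mul {τ : ℝ} (hτ : 0 < τ) :
    Summable fun n : ℕ => rexp (-((n + 1 : ℝ) ^ 2 * π ^ 2 * τ) / 2) := by
  have hv : 0 < π * τ / 2 := by positivity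
  refine ((HurwitzZeta.hasSum_nat_cosKernel₀ 0 hv).summable.div_const 2).congr fun n => ?_
  rw [show -π * (n + 1 : ℝ) ^ 2 * (π * τ / 2) = -((n + 1 : ℝ) ^ 2 * π ^ 2 * τ) / 2 by ring]
  simp

open Real in
theorem integral_dirichletHeatKernel_sq {τ : ℝ} (hτ : 0 < τ) (x : ℝ) :
    ∫ y in Set.Icc (0:ℝ) 1, dirichletHeatKernel τ x y ^ 2
      = 2 * ∑' n : ℕ, rexp (-((n + 1 : ℝ) ^ 2 * π ^ 2 * τ)) * sin ((n + 1 : ℝ) * π * x) ^ 2 := by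
  have hc : Summable fun n : ℕ =>
      |rexp (-((n + 1 : ℝ) ^ 2 * π ^ 2 * τ) / 2) * sin ((n + 1 : ℝ) * π * x)| :=
    (summable_exp_neg_sq_mul hτ).of_nonneg_of_le (fun _ => abs_nonneg _) fun n =>
      (abs_mul_sin_le _ _).trans_eq (abs_of_pos (exp_pos _))
  rw [integral_Icc_eq_integral_Ioc, ← intervalIntegral.integral_of_le zero_le_one]
  simp_rw [dirichletHeatKernel, mul_pow]
  rw [intervalIntegral.integral_const_mul, integral_sineSeries_sq hc, ← tsum_mul_left,
    ← tsum_mul_left]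
  congr 1 with n
  rw [mul_pow, ← exp_nat_mul]
  push_cast
  rw [mul_div_cancel₀ _ two_ne_zero]
  ring

open Real in
theorem integral_sub_rpow_neg_half (t : ℝ) :
    ∫ s in (0:ℝ)..t, (t - s) ^ (-(1 / 2) : ℝ) = 2 * √t := by
  rw [intervalIntegral.integral_comp_sub_left (fun s => s ^ (-(1 / 2) : ℝ)),
    integral_rpow (by norm_num), sqrt_eq_rpow]
  norm_num
  ring

/-- **Heat kernel L² bound.** For every `t > 0`,
`sup_{x∈[0,1]} ∫₀^t ∫₀¹ p_{t-s}(x,y)² dy ds ≤ √(2t)/√π`. -/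
theorem dirichletHeatKernel_sq_integral_le (t : ℝ) (ht : 0 < t) :
    ∀ x ∈ Set.Icc (0:ℝ) 1,
      ∫ s in Set.Icc (0:ℝ) t, ∫ y in Set.Icc (0:ℝ) 1, (dirichletHeatKernel (t - s) x y) ^ 2
        ≤ Real.sqrt (2 * t) / Real.sqrt Real.pi := by
  intro x hx
  have hint : IntervalIntegrable (fun s => (t - s) ^ (-(1 / 2) : ℝ) / (2 * √Real.pi))
      volume 0 t := by
    refine IntervalIntegrable.div_const ?_ _
    simpa using (intervalIntegral.intervalIntegrable_rpow' (a := t) (b := 0)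
      (r := -(1 / 2)) (by norm_num)).comp_sub_left t
  rw [intervalIntegrable_iff_integrableOn_Ioo_of_le ht.le] at hint
  calc
    _ ≤ ∫ s in Set.Ioo (0:ℝ) t, (t - s) ^ (-(1 / 2) : ℝ) / (2 * √Real.pi) := by
      rw [integral_Icc_eq_integral_Ioo]
      refine integral_mono_of_nonneg
        (.of_forall fun s => integral_nonneg fun y => sq_nonneg _) hint ?_
      filter_upwards [ae_restrict_mem measurableSet_Ioo] with s hs
      rw [integral_dirichletHeatKernel_sq (sub_pos.2 hs.2)]
      exact tsum_exp_mul_sin_sq_le hx (sub_pos.2 hs.2)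
    _ = √t / √Real.pi := by
      rw [← integral_Ioc_eq_integral_Ioo, ← intervalIntegral.integral_of_le ht.le,
        intervalIntegral.integral_div, integral_sub_rpow_neg_half t,
        mul_div_mul_left _ _ two_ne_zero]
    _ ≤ √(2 * t) / √Real.pi := by
      gcongr
      linarith
end
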